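/- arXiv:2103.11985 — 3 statements merged into one kernel-verified Lean document; each statement's English description precedes it below -/
import Mathlib

section
/- Let A be a real symmetric positive definite n×n matrix. Then ∑_{x ∈ ℤⁿ} exp(−xᵀAx) = π^{n/2} (det A)^{−1/2} ∑_{k ∈ 2πℤⁿ} exp(−(1/4) kᵀ A^{−1} k), and both series converge absolutely. -/
open Matrix

namespace Matrix

variable {n : ℕ}

/-- The Schur complement of the upper left entry of a symmetric matrix. -/
noncomputable def schurHead (A : Matrix (Fin (n + 1)) (Fin (n + 1)) ℝ) :
    Matrix (Fin n) (Fin n) ℝ :=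
  A.submatrix Fin.succ Fin.succ -
    (A 0 0)⁻¹ • vecMulVec (fun i => A i.succ 0) (fun i => A i.succ 0)

theorem schurHead_mulVec (A : Matrix (Fin (n + 1)) (Fin (n + 1)) ℝ) (y : Fin n → ℝ) :
    A.schurHead *ᵥ y = A.submatrix Fin.succ Fin.succ *ᵥ y -
      ((A 0 0)⁻¹ * ((fun i : Fin n => A i.succ 0) ⬝ᵥ y)) • (fun i => A i.succ 0) := by
  ext i
  simp [schurHead, sub_mulVec, smul_mulVec, vecMulVec_mulVec]
  ring

theorem mulVec_succ {A : Matrix (Fin (n + 1)) (Fin (n + 1)) ℝ} (v : Fin (n + 1) → ℝ)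
    (i : Fin n) :
    (A *ᵥ v) i.succ =
      A i.succ 0 * v 0 + (A.submatrix Fin.succ Fin.succ *ᵥ (fun i : Fin n => v i.succ)) i := by
  simp [mulVec, dotProduct, Fin.sum_univ_succ]

theorem mulVec_zero_of_isSymm {A : Matrix (Fin (n + 1)) (Fin (n + 1)) ℝ} (hA : A.IsSymm)
    (v : Fin (n + 1) → ℝ) :
    (A *ᵥ v) 0 = A 0 0 * v 0 + (fun i : Fin n => A i.succ 0) ⬝ᵥ (fun i : Fin n => v i.succ) := by
  simp [mulVec, dotProduct, Fin.sum_univ_succ, hA.apply]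

theorem dotProduct_succ (v w : Fin (n + 1) → ℝ) :
    v ⬝ᵥ w = v 0 * w 0 + (fun i : Fin n => v i.succ) ⬝ᵥ (fun i : Fin n => w i.succ) := by
  simp [dotProduct, Fin.sum_univ_succ]

theorem dotProduct_mulVec_schurHead (A : Matrix (Fin (n + 1)) (Fin (n + 1)) ℝ)
    (y : Fin n → ℝ) :
    y ⬝ᵥ A.schurHead *ᵥ y = y ⬝ᵥ A.submatrix Fin.succ Fin.succ *ᵥ y -
      (A 0 0)⁻¹ * ((fun i : Fin n => A i.succ 0) ⬝ᵥ y) ^ 2 := by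
  rw [schurHead_mulVec, dotProduct_sub, dotProduct_smul, dotProduct_comm y (fun i => A i.succ 0)]
  simp only [smul_eq_mul]
  ring

theorem dotProduct_mulVec_succ {A : Matrix (Fin (n + 1)) (Fin (n + 1)) ℝ} (hA : A.IsSymm)
    (v : Fin (n + 1) → ℝ) :
    v ⬝ᵥ A *ᵥ v = A 0 0 * v 0 ^ 2 +
      2 * v 0 * ((fun i : Fin n => A i.succ 0) ⬝ᵥ (fun i : Fin n => v i.succ)) +
      (fun i : Fin n => v i.succ) ⬝ᵥ A.submatrix Fin.succ Fin.succ *ᵥ (fun i : Fin n => v i.succ) := by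
  have h : (fun i : Fin n => (A *ᵥ v) i.succ) = v 0 • (fun i => A i.succ 0) +
      A.submatrix Fin.succ Fin.succ *ᵥ (fun i : Fin n => v i.succ) := by
    ext i
    simp [mulVec_succ, mul_comm]
  rw [dotProduct_succ, mulVec_zero_of_isSymm hA, h, dotProduct_add, dotProduct_smul,
    dotProduct_comm (fun i : Fin n => v i.succ) (fun i => A i.succ 0)]
  simp only [smul_eq_mul]
  ring

theorem PosDef.isSymm {A : Matrix (Fin n) (Fin n) ℝ} (hA : A.PosDef) : A.IsSymm := by
  have := hA.isHermitian
  rwa [IsHermitian, conjTranspose_eq_transpose_of_trivial] at this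

theorem PosDef.schurHead {A : Matrix (Fin (n + 1)) (Fin (n + 1)) ℝ} (hA : A.PosDef) :
    A.schurHead.PosDef := by
  have ha : 0 < A 0 0 := hA.diag_pos
  have hs := hA.isSymm
  refine PosDef.of_dotProduct_mulVec_pos ?_ fun {y} hy => ?_
  · ext i j
    simp [Matrix.schurHead, vecMulVec_apply, hs.apply, mul_comm]
  · set t : ℝ := -(A 0 0)⁻¹ * ((fun i : Fin n => A i.succ 0) ⬝ᵥ y)
    have hv : (Fin.cons t y : Fin (n + 1) → ℝ) ≠ 0 := fun h => hy <| by
      ext i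
      simpa using congrFun h i.succ
    have := hA.dotProduct_mulVec_pos hv
    rw [star_trivial, dotProduct_mulVec_succ hs] at this
    simp only [Fin.cons_zero, Fin.cons_succ] at this
    rw [star_trivial, dotProduct_mulVec_schurHead]
    convert this using 1
    simp only [t]
    field_simp
    ring

theorem det_eq_mul_det_schurHead {A : Matrix (Fin (n + 1)) (Fin (n + 1)) ℝ} (hs : A.IsSymm)
    (ha : A 0 0 ≠ 0) : A.det = A 0 0 * A.schurHead.det := by
  let B : Matrix (Fin (n + 1)) (Fin (n + 1)) ℝ :=
    of fun i j => A i j - (Fin.cons 0 (fun i => A i.succ 0 / A 0 0) : Fin (n + 1) → ℝ) i * A 0 j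
  have hB : A.det = B.det := by
    refine det_eq_of_forall_row_eq_smul_add_const
      (Fin.cons 0 (fun i => A i.succ 0 / A 0 0) : Fin (n + 1) → ℝ) 0 rfl fun i j => ?_
    simp [B]
  have h0 : ∀ i : Fin n, B i.succ 0 = 0 := fun i => by
    simp [B]
    field_simp
    ring
  rw [hB, det_succ_column_zero, Fin.sum_univ_succ]
  simp only [h0, mul_zero, zero_mul, Finset.sum_const_zero, add_zero]
  have h00 : B 0 0 = A 0 0 := by simp [B]
  have hsub : B.submatrix (Fin.succAbove 0) Fin.succ = A.schurHead := by
    ext i j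
    simp [B, Matrix.schurHead, vecMulVec_apply, ← hs.apply 0 j.succ]
    ring
  rw [hsub, h00]
  simp

/-- Completing the square for the inverse quadratic form. -/
theorem PosDef.dotProduct_inv_mulVec_succ {A : Matrix (Fin (n + 1)) (Fin (n + 1)) ℝ}
    (hA : A.PosDef) (u : Fin (n + 1) → ℝ) :
    u ⬝ᵥ A⁻¹ *ᵥ u = u 0 ^ 2 / A 0 0 +
      (fun i : Fin n => u i.succ - u 0 * A i.succ 0 / A 0 0) ⬝ᵥ
        A.schurHead⁻¹ *ᵥ (fun i : Fin n => u i.succ - u 0 * A i.succ 0 / A 0 0) := by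
  have ha : 0 < A 0 0 := hA.diag_pos
  have hs := hA.isSymm
  obtain ⟨w, rfl⟩ : ∃ w, u = A *ᵥ w :=
    ⟨A⁻¹ *ᵥ u, by rw [mulVec_mulVec, mul_nonsing_inv _ hA.det_pos.ne'.isUnit, one_mulVec]⟩
  have h : (fun i : Fin n => (A *ᵥ w) i.succ - (A *ᵥ w) 0 * A i.succ 0 / A 0 0) =
      A.schurHead *ᵥ (fun i : Fin n => w i.succ) := by
    ext i
    rw [schurHead_mulVec, mulVec_succ, mulVec_zero_of_isSymm hs]
    simp
    field_simp
    ring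
  rw [h, mulVec_mulVec, mulVec_mulVec, nonsing_inv_mul _ hA.det_pos.ne'.isUnit,
    nonsing_inv_mul _ hA.schurHead.det_pos.ne'.isUnit, one_mulVec, one_mulVec,
    dotProduct_comm, dotProduct_comm (A.schurHead *ᵥ _), dotProduct_mulVec_schurHead,
    dotProduct_mulVec_succ hs, mulVec_zero_of_isSymm hs]
  field_simp
  ring

theorem PosDef.exists_pos_mul_sum_sq_le {A : Matrix (Fin n) (Fin n) ℝ} (hA : A.PosDef) :
    ∃ c : ℝ, 0 < c ∧ ∀ x : Fin n → ℝ, c * ∑ i, x i ^ 2 ≤ x ⬝ᵥ A *ᵥ x := by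
  induction n with
  | zero => exact ⟨1, one_pos, fun x => by simp⟩
  | succ n ih =>
    have hcont : Continuous fun x : Fin (n + 1) → ℝ => x ⬝ᵥ A *ᵥ x := by
      unfold mulVec dotProduct; fun_prop
    obtain ⟨z, hz, hmin⟩ := (isCompact_sphere (0 : Fin (n + 1) → ℝ) 1).exists_isMinOn
      (NormedSpace.sphere_nonempty.mpr zero_le_one) hcont.continuousOn
    have hz0 : z ≠ 0 := by
      rintro rfl; simp at hz
    have hpos : 0 < z ⬝ᵥ A *ᵥ z := by simpa using hA.dotProduct_mulVec_pos hz0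
    refine ⟨(z ⬝ᵥ A *ᵥ z) / (n + 1), by positivity, fun x => ?_⟩
    rcases eq_or_ne x 0 with rfl | hx
    · simp
    have hnx : 0 < ‖x‖ := norm_pos_iff.mpr hx
    have h1 : z ⬝ᵥ A *ᵥ z ≤ (‖x‖⁻¹ • x) ⬝ᵥ A *ᵥ (‖x‖⁻¹ • x) :=
      hmin (by simp [norm_smul, hnx.ne'])
    rw [mulVec_smul, dotProduct_smul, smul_dotProduct, smul_eq_mul, smul_eq_mul] at h1
    have h2 : (z ⬝ᵥ A *ᵥ z) * ‖x‖ ^ 2 ≤ x ⬝ᵥ A *ᵥ x := by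
      calc _ ≤ (‖x‖⁻¹ * (‖x‖⁻¹ * (x ⬝ᵥ A *ᵥ x))) * ‖x‖ ^ 2 := by gcongr
        _ = _ := by field_simp
    have h3 : ∑ i, x i ^ 2 ≤ (n + 1) * ‖x‖ ^ 2 := by
      calc ∑ i, x i ^ 2 ≤ ∑ _i : Fin (n + 1), ‖x‖ ^ 2 := Finset.sum_le_sum fun i _ => by
            rw [← sq_abs, ← Real.norm_eq_abs]
            gcongr
            exact norm_le_pi_norm x i
        _ = _ := by simp
    calc _ ≤ (z ⬝ᵥ A *ᵥ z) / (n + 1) * ((n + 1) * ‖x‖ ^ 2) := by gcongr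
      _ = (z ⬝ᵥ A *ᵥ z) * ‖x‖ ^ 2 := by field_simp
      _ ≤ _ := h2

end Matrix

theorem summable_int_exp_neg_mul_add_sq {c : ℝ} (hc : 0 < c) (v : ℝ) :
    Summable fun x : ℤ => Real.exp (-c * (x + v) ^ 2) := by
  have h := (summable_jacobiTheta₂_term_iff (Complex.I * (c * v / Real.pi : ℝ))
    (Complex.I * (c / Real.pi : ℝ))).mpr (by simp; positivity)
  refine (h.norm.mul_left (Real.exp (-c * v ^ 2))).congr fun x => ?_
  rw [norm_jacobiTheta₂_term, ← Real.exp_add]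
  congr 1
  simp
  field_simp
  ring

theorem summable_exp_neg_mul_sum_add_sq {n : ℕ} {c : ℝ} (hc : 0 < c) (v : Fin n → ℝ) :
    Summable fun x : Fin n → ℤ => Real.exp (-c * ∑ i, (x i + v i) ^ 2) := by
  induction n with
  | zero => exact Summable.of_finite
  | succ n ih =>
    rw [← (Fin.consEquiv fun _ => ℤ).summable_iff]
    refine ((summable_int_exp_neg_mul_add_sq hc (v 0)).mul_of_nonneg
      (ih fun i => v i.succ) (fun _ => by positivity) (fun _ => by positivity)).congr fun p => ?_
    simp [Fin.consEquiv, Fin.sum_univ_succ, ← Real.exp_add]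
    ring

theorem Matrix.PosDef.summable_exp_neg_mul {n : ℕ} {A : Matrix (Fin n) (Fin n) ℝ}
    (hA : A.PosDef) {c : ℝ} (hc : 0 < c) (v : Fin n → ℝ) :
    Summable fun x : Fin n → ℤ => Real.exp (-c *
      ((fun i => (x i : ℝ) + v i) ⬝ᵥ A *ᵥ (fun i => (x i : ℝ) + v i))) := by
  obtain ⟨d, hd, h⟩ := hA.exists_pos_mul_sum_sq_le
  refine (summable_exp_neg_mul_sum_add_sq (mul_pos hc hd) v).of_nonneg_of_le
    (fun _ => by positivity) fun x => ?_
  have := mul_le_mul_of_nonneg_left (h fun i => (x i : ℝ) + v i) hc.le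
  refine Real.exp_le_exp.mpr ?_
  linarith

/-- One-dimensional Poisson summation for `exp (-a x² - 2 s x + 2 π i b x)`. -/
theorem tsum_cexp_neg_mul_sq_add {a : ℝ} (ha : 0 < a) (s b : ℝ) :
    ∑' x : ℤ, Complex.exp (-(a * x ^ 2 + 2 * x * s) + 2 * Real.pi * Complex.I * (b * x)) =
      (Real.sqrt (Real.pi / a) : ℝ) * ∑' m : ℤ, Complex.exp (-(Real.pi ^ 2 * (m - b) ^ 2 / a) +
        2 * Real.pi * Complex.I * ((m - b) * s / a) + s ^ 2 / a) := by
  have hpi : (Real.pi : ℂ) ≠ 0 := by exact_mod_cast Real.pi_ne_zero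
  have ha' : (a : ℂ) ≠ 0 := by exact_mod_cast ha.ne'
  have h := Complex.tsum_exp_neg_quadratic (a := (a / Real.pi : ℝ))
    (by rw [Complex.ofReal_re]; positivity) (-s / Real.pi + Complex.I * b)
  have hsq : (1 : ℂ) / ((a / Real.pi : ℝ) : ℂ) ^ (1 / 2 : ℂ) = (Real.sqrt (Real.pi / a) : ℝ) := by
    have : (1 / 2 : ℂ) = ((1 / 2 : ℝ) : ℂ) := by norm_num
    rw [this, ← Complex.ofReal_cpow (by positivity), ← Real.sqrt_eq_rpow, ← inv_div a Real.pi,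
      Real.sqrt_inv]
    simp
  rw [hsq] at h
  convert h using 3 with x
  · push_cast
    field_simp
    ring_nf
  · ext m
    congr 1
    push_cast
    field_simp
    ring_nf
    simp only [Complex.I_sq, Complex.I_pow_three, Complex.I_pow_four]
    ring

theorem tsum_fin_succ_eq {n : ℕ} {f : (Fin (n + 1) → ℤ) → ℂ} (hf : Summable f) :
    ∑' x, f x = ∑' (t : ℤ) (y : Fin n → ℤ), f (Fin.cons t y) := by
  rw [← (Fin.consEquiv fun _ => ℤ).tsum_eq]
  exact ((Fin.consEquiv fun _ => ℤ).summable_iff.mpr hf).tsum_prod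

theorem tsum_fin_succ_eq' {n : ℕ} {f : (Fin (n + 1) → ℤ) → ℂ} (hf : Summable f) :
    ∑' x, f x = ∑' (y : Fin n → ℤ) (t : ℤ), f (Fin.cons t y) := by
  rw [tsum_fin_succ_eq hf]
  have h : Summable (Function.uncurry fun (t : ℤ) (y : Fin n → ℤ) => f (Fin.cons t y)) :=
    (Fin.consEquiv fun _ => ℤ).summable_iff.mpr hf
  exact h.tsum_comm.symm

/-- **Poisson summation** for a Gaussian twisted by a unitary character of `ℝⁿ`. -/
theorem Matrix.PosDef.tsum_cexp_neg_dotProduct_mulVec {n : ℕ} {A : Matrix (Fin n) (Fin n) ℝ}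
    (hA : A.PosDef) (b : Fin n → ℝ) :
    ∑' x : Fin n → ℤ, Complex.exp (
        -((((fun i => (x i : ℝ)) ⬝ᵥ A *ᵥ (fun i => (x i : ℝ)) : ℝ)) : ℂ) +
          2 * Real.pi * Complex.I * ((b ⬝ᵥ (fun i => (x i : ℝ)) : ℝ) : ℂ)) =
      (Real.pi ^ ((n : ℝ) / 2) / Real.sqrt A.det : ℝ) * ∑' m : Fin n → ℤ,
        ((Real.exp (-Real.pi ^ 2 * ((fun i => (m i : ℝ) - b i) ⬝ᵥ
          A⁻¹ *ᵥ (fun i => (m i : ℝ) - b i))) : ℝ) : ℂ) := by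
  induction n with
  | zero => simp
  | succ n ih =>
    have ha : 0 < A 0 0 := hA.diag_pos
    have hs := hA.isSymm
    have hS := hA.schurHead
    have hnorm : ∀ r t : ℝ, ‖Complex.exp (-(r : ℂ) + 2 * Real.pi * Complex.I * (t : ℂ))‖ =
        Real.exp (-r) := fun r t => by simp [Complex.norm_exp]
    have hF : Summable fun x : Fin (n + 1) → ℤ => Complex.exp (
        -((((fun i => (x i : ℝ)) ⬝ᵥ A *ᵥ (fun i => (x i : ℝ)) : ℝ)) : ℂ) +
          2 * Real.pi * Complex.I * ((b ⬝ᵥ (fun i => (x i : ℝ)) : ℝ) : ℂ)) := by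
      refine Summable.of_norm ?_
      simp only [hnorm]
      simpa using hA.summable_exp_neg_mul one_pos 0
    have hH : Summable fun m : Fin (n + 1) → ℤ =>
        ((Real.exp (-Real.pi ^ 2 * ((fun i => (m i : ℝ) - b i) ⬝ᵥ
          A⁻¹ *ᵥ (fun i => (m i : ℝ) - b i))) : ℝ) : ℂ) := by
      rw [Complex.summable_ofReal]
      exact hA.inv.summable_exp_neg_mul (pow_pos Real.pi_pos 2) (-b)
    let B : ℤ → Fin n → ℝ := fun m i => b i.succ + (m - b 0) * A i.succ 0 / A 0 0
    let G : (Fin n → ℤ) → ℤ → ℂ := fun y m =>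
      (Real.exp (-Real.pi ^ 2 / A 0 0 * (m + -b 0) ^ 2) : ℝ) * Complex.exp (
        -((((fun i => (y i : ℝ)) ⬝ᵥ A.schurHead *ᵥ (fun i => (y i : ℝ)) : ℝ)) : ℂ) +
          2 * Real.pi * Complex.I * ((B m ⬝ᵥ (fun i => (y i : ℝ)) : ℝ) : ℂ))
    have hG : Summable (Function.uncurry G) := by
      refine Summable.of_norm ?_
      have h1 : Summable fun y : Fin n → ℤ => Real.exp
          (-((fun i => (y i : ℝ)) ⬝ᵥ A.schurHead *ᵥ (fun i => (y i : ℝ)))) := by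
        simpa using hS.summable_exp_neg_mul one_pos 0
      have h2 := summable_int_exp_neg_mul_add_sq
        (div_pos (pow_pos Real.pi_pos 2) ha) (-b 0)
      refine (h1.mul_of_nonneg h2 (fun _ => by positivity) (fun _ => by positivity)).congr
        fun p => ?_
      simp only [Function.uncurry, G, norm_mul, hnorm, Complex.norm_real, Real.norm_eq_abs,
        Real.abs_exp, neg_div]
      exact mul_comm _ _
    have hinner : ∀ y : Fin n → ℤ, ∑' t : ℤ, Complex.exp (
        -((((fun i => ((Fin.cons t y : Fin (n + 1) → ℤ) i : ℝ)) ⬝ᵥ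
          A *ᵥ (fun i => ((Fin.cons t y : Fin (n + 1) → ℤ) i : ℝ)) : ℝ)) : ℂ) +
          2 * Real.pi * Complex.I *
            ((b ⬝ᵥ (fun i => ((Fin.cons t y : Fin (n + 1) → ℤ) i : ℝ)) : ℝ) : ℂ)) =
        (Real.sqrt (Real.pi / A 0 0) : ℝ) * ∑' m : ℤ, G y m := by
      intro y
      set z : Fin n → ℝ := fun i => (y i : ℝ) with hz
      set s : ℝ := (fun i : Fin n => A i.succ 0) ⬝ᵥ z with hs'
      have h1 : ∀ t : ℤ, Complex.exp (
          -((((fun i => ((Fin.cons t y : Fin (n + 1) → ℤ) i : ℝ)) ⬝ᵥ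
            A *ᵥ (fun i => ((Fin.cons t y : Fin (n + 1) → ℤ) i : ℝ)) : ℝ)) : ℂ) +
            2 * Real.pi * Complex.I *
              ((b ⬝ᵥ (fun i => ((Fin.cons t y : Fin (n + 1) → ℤ) i : ℝ)) : ℝ) : ℂ)) =
          Complex.exp (-((z ⬝ᵥ A.submatrix Fin.succ Fin.succ *ᵥ z : ℝ) : ℂ) +
            2 * Real.pi * Complex.I * (((fun i : Fin n => b i.succ) ⬝ᵥ z : ℝ) : ℂ)) *
          Complex.exp (-((A 0 0 : ℝ) * t ^ 2 + 2 * t * s) +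
            2 * Real.pi * Complex.I * ((b 0 : ℝ) * t)) := by
        intro t
        rw [← Complex.exp_add, dotProduct_mulVec_succ hs, dotProduct_succ b]
        simp only [Fin.cons_zero, Fin.cons_succ]
        congr 1
        simp only [← hz, ← hs']
        push_cast
        ring
      simp only [h1]
      rw [tsum_mul_left, tsum_cexp_neg_mul_sq_add ha, mul_left_comm, ← tsum_mul_left]
      congr 2
      ext m
      have hB : B m ⬝ᵥ z = (fun i : Fin n => b i.succ) ⬝ᵥ z + (m - b 0) / A 0 0 * s := by
        have : B m = (fun i : Fin n => b i.succ) +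
            ((m - b 0) / A 0 0) • (fun i : Fin n => A i.succ 0) := by
          ext i
          simp [B]
          ring
        rw [this, add_dotProduct, smul_dotProduct, smul_eq_mul]
      simp only [G, ← hz]
      rw [hB, dotProduct_mulVec_schurHead, ← hs', Complex.ofReal_exp, ← Complex.exp_add,
        ← Complex.exp_add]
      congr 1
      push_cast
      ring
    rw [tsum_fin_succ_eq' hF, tsum_fin_succ_eq hH]
    simp only [hinner]
    rw [tsum_mul_left, ← hG.tsum_comm]
    have houter : ∀ m : ℤ, ∑' y : Fin n → ℤ, G y m =
        (Real.pi ^ ((n : ℝ) / 2) / Real.sqrt A.schurHead.det : ℝ) * ∑' y : Fin n → ℤ,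
          ((Real.exp (-Real.pi ^ 2 *
            ((fun i => ((Fin.cons m y : Fin (n + 1) → ℤ) i : ℝ) - b i) ⬝ᵥ
              A⁻¹ *ᵥ (fun i => ((Fin.cons m y : Fin (n + 1) → ℤ) i : ℝ) - b i))) : ℝ) : ℂ) := by
      intro m
      simp only [G]
      rw [tsum_mul_left, ih hS, mul_left_comm, ← tsum_mul_left]
      congr 2
      ext y
      rw [← Complex.ofReal_mul, ← Real.exp_add, hA.dotProduct_inv_mulVec_succ]
      have hv : (fun i : Fin n => (y i : ℝ) - B m i) = fun i : Fin n =>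
          ((y i : ℝ) - b i.succ) - ((m : ℝ) - b 0) * A i.succ 0 / A 0 0 := by
        ext i
        simp only [B]
        ring
      simp only [Fin.cons_zero, Fin.cons_succ, hv]
      congr 2
      ring
    simp only [houter]
    rw [tsum_mul_left, ← mul_assoc, ← Complex.ofReal_mul]
    congr 2
    rw [det_eq_mul_det_schurHead hs ha.ne', Real.sqrt_mul ha.le, Real.sqrt_div Real.pi_pos.le,
      Real.sqrt_eq_rpow Real.pi, div_mul_div_comm, ← Real.rpow_add Real.pi_pos]
    congr 2
    push_cast
    ring

theorem stmt4 (n : ℕ) (A : Matrix (Fin n) (Fin n) ℝ) (hA : A.PosDef) (hAs : A.IsSymm) :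
    Summable (fun x : Fin n → ℤ =>
      Real.exp (-((fun i => (x i : ℝ)) ⬝ᵥ A.mulVec (fun i => (x i : ℝ))))) ∧
    Summable (fun m : Fin n → ℤ =>
      Real.exp (-(1 / 4) *
        ((fun i => 2 * Real.pi * (m i : ℝ)) ⬝ᵥ A⁻¹.mulVec (fun i => 2 * Real.pi * (m i : ℝ))))) ∧
    (∑' x : Fin n → ℤ,
        Real.exp (-((fun i => (x i : ℝ)) ⬝ᵥ A.mulVec (fun i => (x i : ℝ)))))
      = Real.pi ^ ((n : ℝ) / 2) / Real.sqrt A.det *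
        ∑' m : Fin n → ℤ,
          Real.exp (-(1 / 4) *
            ((fun i => 2 * Real.pi * (m i : ℝ)) ⬝ᵥ A⁻¹.mulVec (fun i => 2 * Real.pi * (m i : ℝ)))) := by
  have h : ∀ m : Fin n → ℤ, -(1 / 4) * ((fun i => 2 * Real.pi * (m i : ℝ)) ⬝ᵥ
      A⁻¹ *ᵥ (fun i => 2 * Real.pi * (m i : ℝ))) =
      -Real.pi ^ 2 * ((fun i => (m i : ℝ)) ⬝ᵥ A⁻¹ *ᵥ (fun i => (m i : ℝ))) := fun m => by
    have : (fun i => 2 * Real.pi * (m i : ℝ)) = (2 * Real.pi) • fun i => (m i : ℝ) := rfl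
    rw [this, mulVec_smul, dotProduct_smul, smul_dotProduct, smul_eq_mul, smul_eq_mul]
    ring
  simp only [h]
  refine ⟨?_, ?_, ?_⟩
  · simpa using hA.summable_exp_neg_mul one_pos 0
  · simpa using hA.inv.summable_exp_neg_mul (pow_pos Real.pi_pos 2) 0
  · have := hA.tsum_cexp_neg_dotProduct_mulVec 0
    simp only [zero_dotProduct, Pi.zero_apply, sub_zero, Complex.ofReal_zero, mul_zero,
      add_zero] at this
    exact_mod_cast this
end

section
/- With Ω_Λ = {x ∈ ℤ^Λ : x_0 = 0}, H_Λ(x) = ∑_{{i,j} edge} (x_i − x_j)², β > 0, and β* = (4β)^{−1}, the duality formula holds: ∑_{x∈Ω_Λ} e^{−β H_Λ(x)} = (π/β)^{(|Λ|−1)/2} det(−Δ_{0ᶜ0ᶜ})^{−1/2} ∑_{k∈2πℤ^{Λ∖{0}}} e^{β* kᵀ(Δ_{0ᶜ0ᶜ})^{−1}k}. -/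
open Matrix Filter

/-- The discrete two-dimensional torus `(ℤ/Nℤ)²`. -/
abbrev Torus (N : ℕ) := ZMod N × ZMod N

/-- The four nearest-neighbor steps on the torus. -/
def torusSteps (N : ℕ) : List (Torus N) := [(1, 0), (-1, 0), (0, 1), (0, -1)]

/-- One-step transition kernel of simple random walk on the torus:
each of the four steps is taken with probability `1/4`. -/
noncomputable def srwKernel (N : ℕ) : Matrix (Torus N) (Torus N) ℝ :=
  fun i j => ((torusSteps N).count (j - i) : ℝ) / 4

/-- The lattice Laplacian on the torus: `Δ_ij = 1` for neighbors `i ∼ j`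
(counted with multiplicity), `Δ_ii = -4`, and `0` otherwise. -/
noncomputable def lap (N : ℕ) : Matrix (Torus N) (Torus N) ℝ :=
  fun i j => if i = j then -4 else ((torusSteps N).count (j - i) : ℝ)

/-- The Green's function
`G_ij = lim_{λ↓0} ∑_{t≥0} (P_i(X_t = j) − 1/|Λ|) e^{−λt}` of simple random walk. -/
noncomputable def green (N : ℕ) [NeZero N] (i j : Torus N) : ℝ :=
  limUnder (nhdsWithin (0 : ℝ) (Set.Ioi 0))
    (fun lam : ℝ =>
      ∑' t : ℕ, ((srwKernel N ^ t) i j - 1 / (N ^ 2 : ℝ)) * Real.exp (-lam * t))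

/-- The discrete Gaussian Hamiltonian `H_Λ(x) = ∑_{{i,j} ∈ E_Λ} (x_i − x_j)²`,
summing over the nearest-neighbor edges of the torus. -/
noncomputable def dgHam (N : ℕ) [NeZero N] (f : Torus N → ℤ) : ℝ :=
  ∑ i : Torus N,
    (((f (i + (1, 0)) - f i : ℤ) : ℝ) ^ 2 + ((f (i + (0, 1)) - f i : ℤ) : ℝ) ^ 2)

open Complex in
/-- The term of a Gaussian lattice sum with real quadratic form `A` and complex linear part `b`. -/
noncomputable def gaussTerm {α : Type*} [Fintype α] (A : Matrix α α ℝ) (b : α → ℂ)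
    (x : α → ℤ) : ℂ :=
  cexp (-Real.pi * ((fun i => (x i : ℂ)) ⬝ᵥ A.map ofReal *ᵥ (fun i => (x i : ℂ))) +
    2 * Real.pi * (b ⬝ᵥ (fun i => (x i : ℂ))))

open Complex in
/-- The term of the lattice sum Poisson-dual to that of `gaussTerm A b`. -/
noncomputable def gaussDualTerm {α : Type*} [Fintype α] [DecidableEq α] (A : Matrix α α ℝ)
    (b : α → ℂ) (m : α → ℤ) : ℂ :=
  cexp (-Real.pi * ((fun i => (m i : ℂ) + I * b i) ⬝ᵥ
    A⁻¹.map ofReal *ᵥ (fun i => (m i : ℂ) + I * b i)))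

theorem Matrix.PosDef.exists_mul_sum_sq_le {α : Type*} [Fintype α] {A : Matrix α α ℝ}
    (hA : A.PosDef) : ∃ c > 0, ∀ x : α → ℝ, c * ∑ i, x i ^ 2 ≤ x ⬝ᵥ A *ᵥ x := by
  rcases isEmpty_or_nonempty α with h | h
  · exact ⟨1, one_pos, fun x => by simp [dotProduct]⟩
  have hcont : Continuous fun x : α → ℝ => x ⬝ᵥ A *ᵥ x := by fun_prop
  obtain ⟨z, hz, hmin⟩ := (isCompact_sphere (0 : α → ℝ) 1).exists_isMinOn
    (NormedSpace.sphere_nonempty.2 zero_le_one) hcont.continuousOn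
  have hz0 : z ≠ 0 := by
    rintro rfl
    simp at hz
  have hpos : 0 < z ⬝ᵥ A *ᵥ z := by simpa using hA.dotProduct_mulVec_pos hz0
  refine ⟨(z ⬝ᵥ A *ᵥ z) / Fintype.card α, by positivity, fun x => ?_⟩
  have hsum : ∑ i, x i ^ 2 ≤ Fintype.card α * ‖x‖ ^ 2 := by
    calc ∑ i, x i ^ 2 ≤ ∑ _i : α, ‖x‖ ^ 2 := Finset.sum_le_sum fun i _ => by
          rw [← sq_abs, ← Real.norm_eq_abs]
          gcongr
          exact norm_le_pi_norm x i
      _ = _ := by simp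
  have hcard : (0 : ℝ) < Fintype.card α := by positivity
  calc (z ⬝ᵥ A *ᵥ z) / Fintype.card α * ∑ i, x i ^ 2
      ≤ (z ⬝ᵥ A *ᵥ z) / Fintype.card α * (Fintype.card α * ‖x‖ ^ 2) := by gcongr
    _ = ‖x‖ ^ 2 * (z ⬝ᵥ A *ᵥ z) := by field_simp
    _ ≤ x ⬝ᵥ A *ᵥ x := by
      rcases eq_or_ne x 0 with rfl | hx
      · simp
      have hn : 0 < ‖x‖ := norm_pos_iff.2 hx
      have hm := isMinOn_iff.1 hmin _ (show ‖x‖⁻¹ • x ∈ Metric.sphere (0 : α → ℝ) 1 by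
        simp [norm_smul, hn.ne'])
      simp only [mulVec_smul, dotProduct_smul, smul_dotProduct,
        smul_eq_mul] at hm
      calc ‖x‖ ^ 2 * (z ⬝ᵥ A *ᵥ z) ≤ ‖x‖ ^ 2 * (‖x‖⁻¹ * (‖x‖⁻¹ * (x ⬝ᵥ A *ᵥ x))) := by gcongr
        _ = _ := by field_simp

theorem Summable.prod_pi_of_nonneg {ι : Type*} [Fintype ι] {κ : Type*} (f : ι → κ → ℝ)
    (h0 : ∀ i k, 0 ≤ f i k) (hf : ∀ i, Summable (f i)) :
    Summable fun x : ι → κ => ∏ i, f i (x i) := by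
  classical
  refine summable_of_sum_le (c := ∏ i, ∑' k, f i k) (fun x => Finset.prod_nonneg fun i _ => h0 i _)
    fun s => ?_
  let t : ι → Finset κ := fun i => s.image (· i)
  calc ∑ x ∈ s, ∏ i, f i (x i) ≤ ∑ x ∈ Fintype.piFinset t, ∏ i, f i (x i) := by
        refine Finset.sum_le_sum_of_subset_of_nonneg (fun x hx => ?_)
          fun x _ _ => Finset.prod_nonneg fun i _ => h0 i _
        exact Fintype.mem_piFinset.2 fun i => Finset.mem_image_of_mem _ hx
    _ = ∏ i, ∑ k ∈ t i, f i k := (Finset.prod_univ_sum t fun i k => f i k).symm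
    _ ≤ _ := Finset.prod_le_prod (fun i _ => Finset.sum_nonneg fun k _ => h0 i k)
        fun i _ => (hf i).sum_le_tsum _ fun k _ => h0 i k

open Complex in
theorem summable_cexp_neg_quadratic {a : ℝ} (ha : 0 < a) (b : ℂ) :
    Summable fun n : ℤ => cexp (-Real.pi * a * n ^ 2 + 2 * Real.pi * b * n) := by
  have h := (summable_jacobiTheta₂_term_iff (-I * b) (I * a)).2 (by simpa using ha)
  refine h.congr fun n => ?_
  rw [jacobiTheta₂_term]
  congr 1
  linear_combination (-2 * Real.pi * b * n + Real.pi * n ^ 2 * a) * I_sq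

theorem norm_gaussTerm {α : Type*} [Fintype α] (A : Matrix α α ℝ) (b : α → ℂ) (x : α → ℤ) :
    ‖gaussTerm A b x‖ = Real.exp (-Real.pi * ((fun i => (x i : ℝ)) ⬝ᵥ A *ᵥ (fun i => (x i : ℝ))) +
      2 * Real.pi * ((fun i => (b i).re) ⬝ᵥ (fun i => (x i : ℝ)))) := by
  rw [gaussTerm, Complex.norm_exp]
  congr 1
  have h1 : ((fun i => (x i : ℂ)) ⬝ᵥ A.map Complex.ofReal *ᵥ (fun i => (x i : ℂ))) =
      (((fun i => (x i : ℝ)) ⬝ᵥ A *ᵥ (fun i => (x i : ℝ)) : ℝ) : ℂ) := by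
    simp [dotProduct, mulVec]
  have h2 : (b ⬝ᵥ (fun i => (x i : ℂ))).re = (fun i => (b i).re) ⬝ᵥ (fun i => (x i : ℝ)) := by
    simp [dotProduct]
  rw [h1, ← h2]
  simp [Complex.add_re, Complex.mul_re]

theorem summable_gaussTerm {α : Type*} [Fintype α] {A : Matrix α α ℝ} (hA : A.PosDef)
    (b : α → ℂ) : Summable (gaussTerm A b) := by
  obtain ⟨c, hc, h⟩ := hA.exists_mul_sum_sq_le
  refine Summable.of_norm_bounded (Summable.prod_pi_of_nonneg
    (fun i (n : ℤ) => ‖Complex.exp (-Real.pi * c * n ^ 2 + 2 * Real.pi * b i * n)‖)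
    (fun _ _ => norm_nonneg _) fun i => (summable_cexp_neg_quadratic hc (b i)).norm) fun x => ?_
  rw [← norm_prod, ← Complex.exp_sum, norm_gaussTerm, Complex.norm_exp, Real.exp_le_exp]
  have := h fun i => (x i : ℝ)
  have e : (∑ i, (-Real.pi * c * (x i : ℂ) ^ 2 + 2 * Real.pi * b i * (x i : ℂ))).re =
      -Real.pi * (c * ∑ i, (x i : ℝ) ^ 2) +
        2 * Real.pi * ((fun i => (b i).re) ⬝ᵥ (fun i => (x i : ℝ))) := by
    rw [Complex.re_sum]
    simp only [dotProduct, Finset.mul_sum, ← Finset.sum_add_distrib]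
    refine Finset.sum_congr rfl fun i _ => ?_
    simp [Complex.mul_re, Complex.add_re, pow_two]
    ring
  rw [e]
  nlinarith [Real.pi_pos]

theorem gaussDualTerm_eq {α : Type*} [Fintype α] [DecidableEq α] {A : Matrix α α ℝ}
    (hA : A.PosDef) (b : α → ℂ) (m : α → ℤ) :
    gaussDualTerm A b m = Complex.exp (Real.pi * (b ⬝ᵥ A⁻¹.map Complex.ofReal *ᵥ b)) *
      gaussTerm A⁻¹ (-Complex.I • A⁻¹.map Complex.ofReal *ᵥ b) m := by
  rw [gaussDualTerm, gaussTerm, ← Complex.exp_add]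
  congr 1
  have hs : (A⁻¹.map Complex.ofReal)ᵀ = A⁻¹.map Complex.ofReal := by
    rw [← transpose_map]
    congr 1
    simpa using hA.inv.isHermitian.eq
  set B := A⁻¹.map Complex.ofReal
  set x : α → ℂ := fun i => (m i : ℂ)
  have hw : (fun i => (m i : ℂ) + Complex.I * b i) = x + Complex.I • b := by
    ext i; simp [x]
  have hc : b ⬝ᵥ B *ᵥ x = x ⬝ᵥ B *ᵥ b := by
    rw [dotProduct_mulVec, ← mulVec_transpose, hs, dotProduct_comm]
  rw [hw]
  simp only [mulVec_add, mulVec_smul, dotProduct_add, add_dotProduct, smul_dotProduct,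
    dotProduct_smul, smul_eq_mul, hc, dotProduct_comm (B *ᵥ b) x]
  linear_combination (-Real.pi * (b ⬝ᵥ B *ᵥ b)) * Complex.I_sq

theorem summable_gaussDualTerm {α : Type*} [Fintype α] [DecidableEq α] {A : Matrix α α ℝ}
    (hA : A.PosDef) (b : α → ℂ) : Summable (gaussDualTerm A b) := by
  refine ((summable_gaussTerm hA.inv _).mul_left _).congr fun m => (gaussDualTerm_eq hA b m).symm

/-- The symmetric matrix with corner entry `a`, border `c` and remaining block `B`. -/
def borderedMatrix {R α : Type*} (a : R) (c : α → R) (B : Matrix α α R) :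
    Matrix (Unit ⊕ α) (Unit ⊕ α) R :=
  fromBlocks (of fun _ _ => a) (of fun _ j => c j) (of fun i _ => c i) B

theorem borderedMatrix_mulVec {R α : Type*} [CommRing R] [Fintype α] (a : R) (c : α → R)
    (B : Matrix α α R) (t : R) (y : α → R) :
    borderedMatrix a c B *ᵥ Sum.elim (fun _ => t) y =
      Sum.elim (fun _ => a * t + c ⬝ᵥ y) (t • c + B *ᵥ y) := by
  rw [borderedMatrix, fromBlocks_mulVec]
  ext (i | i) <;> simp [mulVec, dotProduct, mul_comm]

theorem dotProduct_borderedMatrix_mulVec {R α : Type*} [CommRing R] [Fintype α] (a : R) (c : α → R)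
    (B : Matrix α α R) (t : R) (y : α → R) :
    Sum.elim (fun _ => t) y ⬝ᵥ borderedMatrix a c B *ᵥ Sum.elim (fun _ => t) y =
      a * t ^ 2 + 2 * t * (c ⬝ᵥ y) + y ⬝ᵥ B *ᵥ y := by
  rw [borderedMatrix_mulVec, sumElim_dotProduct_sumElim, dotProduct_add, dotProduct_smul,
    dotProduct_comm y c]
  simp [dotProduct]
  ring

theorem dotProduct_schur_mulVec {K α : Type*} [Field K] [Fintype α] (a : K) (c : α → K)
    (B : Matrix α α K) (y : α → K) :
    y ⬝ᵥ (B - a⁻¹ • vecMulVec c c) *ᵥ y = y ⬝ᵥ B *ᵥ y - a⁻¹ * (c ⬝ᵥ y) ^ 2 := by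
  rw [sub_mulVec, dotProduct_sub, smul_mulVec, vecMulVec_mulVec, dotProduct_smul]
  simp [dotProduct_comm y c, pow_two]

theorem det_borderedMatrix {K α : Type*} [Field K] [Fintype α] [DecidableEq α] {a : K} (ha : a ≠ 0)
    (c : α → K) (B : Matrix α α K) :
    (borderedMatrix a c B).det = a * (B - a⁻¹ • vecMulVec c c).det := by
  let : Invertible (of fun _ _ : Unit => a) :=
    ⟨of fun _ _ => a⁻¹, by ext; simp [mul_apply, ha], by ext; simp [mul_apply, ha]⟩
  rw [borderedMatrix, det_fromBlocks₁₁]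
  congr 1
  · simp
  · congr 2
    ext i j
    have hinv : ⅟(of fun _ _ : Unit => a) = of fun _ _ => a⁻¹ := rfl
    simp [hinv, mul_apply, vecMulVec_apply]
    ring

theorem inv_borderedMatrix_mulVec {K α : Type*} [Field K] [Fintype α] [DecidableEq α] {a : K}
    (ha : a ≠ 0) (c : α → K) (B : Matrix α α K)
    (hS : IsUnit (B - a⁻¹ • vecMulVec c c).det) (s : K) (u : α → K) :
    Sum.elim (fun _ => s) u ⬝ᵥ (borderedMatrix a c B)⁻¹ *ᵥ Sum.elim (fun _ => s) u =
      s ^ 2 / a + (u - (s / a) • c) ⬝ᵥ (B - a⁻¹ • vecMulVec c c)⁻¹ *ᵥ (u - (s / a) • c) := by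
  have hM : IsUnit (borderedMatrix a c B).det := by
    rw [det_borderedMatrix ha]
    exact (isUnit_iff_ne_zero.2 ha).mul hS
  set S := B - a⁻¹ • vecMulVec c c with hSdef
  set v := S⁻¹ *ᵥ (u - (s / a) • c) with hv
  have hSv : B *ᵥ v = u - (s / a) • c + (a⁻¹ * (c ⬝ᵥ v)) • c := by
    have h1 : S *ᵥ v = u - (s / a) • c := by
      rw [hv, mulVec_mulVec, mul_nonsing_inv _ hS, one_mulVec]
    rw [hSdef, sub_mulVec, smul_mulVec, vecMulVec_mulVec] at h1
    rw [← h1]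
    ext i
    simp
    ring
  have hw : Sum.elim (fun _ => s) u =
      borderedMatrix a c B *ᵥ Sum.elim (fun _ => (s - c ⬝ᵥ v) / a) v := by
    rw [borderedMatrix_mulVec, hSv]
    ext (i | i)
    · simp
      field_simp
      ring
    · simp
      field_simp
      ring
  conv_lhs => rw [hw, mulVec_mulVec, nonsing_inv_mul _ hM, one_mulVec, ← hw]
  rw [sumElim_dotProduct_sumElim, sub_dotProduct, smul_dotProduct]
  simp [dotProduct]
  field_simp
  ring

theorem posDef_schur_of_posDef_borderedMatrix {α : Type*} [Fintype α] {a : ℝ} {c : α → ℝ}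
    {B : Matrix α α ℝ} (h : (borderedMatrix a c B).PosDef) :
    0 < a ∧ (B - a⁻¹ • vecMulVec c c).PosDef := by
  have ha : 0 < a := h.diag_pos (i := Sum.inl ())
  refine ⟨ha, .of_dotProduct_mulVec_pos ?_ fun y hy => ?_⟩
  · ext i j
    have := h.isHermitian.apply (Sum.inr i) (Sum.inr j)
    simp only [borderedMatrix, fromBlocks_apply₂₂] at this
    simp only [conjTranspose_apply, Matrix.sub_apply, star_trivial, Matrix.smul_apply, vecMulVec_apply] at this ⊢
    rw [this, mul_comm (c i)]
  · have hne : Sum.elim (fun _ : Unit => -(a⁻¹ * (c ⬝ᵥ y))) y ≠ 0 := fun h0 =>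
      hy (funext fun i => congrFun h0 (Sum.inr i))
    have := h.dotProduct_mulVec_pos hne
    rw [star_trivial, dotProduct_borderedMatrix_mulVec] at this
    rw [star_trivial, dotProduct_schur_mulVec]
    convert! this using 1
    field_simp
    ring

theorem map_inv_ofReal {α : Type*} [Fintype α] [DecidableEq α] {A : Matrix α α ℝ}
    (hA : IsUnit A) : A⁻¹.map Complex.ofReal = (A.map Complex.ofReal)⁻¹ := by
  refine (inv_eq_left_inv ?_).symm
  have h := congrArg Complex.ofRealHom.mapMatrix
    (nonsing_inv_mul A ((isUnit_iff_isUnit_det A).1 hA))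
  rwa [map_mul, map_one] at h

open Complex in
theorem gaussTerm_borderedMatrix {α : Type*} [Fintype α] (a : ℝ) (c : α → ℝ) (B : Matrix α α ℝ)
    (b₀ : ℂ) (b : α → ℂ) (t : ℤ) (y : α → ℤ) :
    gaussTerm (borderedMatrix a c B) (Sum.elim (fun _ => b₀) b) (Sum.elim (fun _ => t) y) =
      cexp (-Real.pi * a * t ^ 2 +
        2 * Real.pi * (b₀ - (fun i => (c i : ℂ)) ⬝ᵥ (fun i => (y i : ℂ))) * t) *
      gaussTerm B b y := by
  have hM : (borderedMatrix a c B).map ofReal =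
      borderedMatrix (a : ℂ) (fun i => (c i : ℂ)) (B.map ofReal) := by
    ext (i | i) (j | j) <;> rfl
  have hx : (fun i => ((Sum.elim (fun _ : Unit => t) y i : ℤ) : ℂ)) =
      Sum.elim (fun _ => (t : ℂ)) (fun i => (y i : ℂ)) := by
    ext (i | i) <;> rfl
  rw [gaussTerm, gaussTerm, ← Complex.exp_add, hM, hx, dotProduct_borderedMatrix_mulVec,
    sumElim_dotProduct_sumElim]
  congr 1
  have : (fun _ : Unit => b₀) ⬝ᵥ (fun _ => (t : ℂ)) = b₀ * t := by simp [dotProduct]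
  rw [this]
  ring

open Complex in
theorem cexp_mul_gaussTerm_eq_schur {α : Type*} [Fintype α] {a : ℝ} (ha : 0 < a) (c : α → ℝ)
    (B : Matrix α α ℝ) (b₀ : ℂ) (b : α → ℂ) (s : ℤ) (y : α → ℤ) :
    cexp (-Real.pi / a *
        (s + I * (b₀ - (fun i => (c i : ℂ)) ⬝ᵥ (fun i => (y i : ℂ)))) ^ 2) * gaussTerm B b y =
      cexp (-Real.pi / a * (s + I * b₀) ^ 2) *
        gaussTerm (B - a⁻¹ • vecMulVec c c)
          (b + (I * (s + I * b₀) / a) • fun i => (c i : ℂ)) y := by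
  have hM : (B - a⁻¹ • vecMulVec c c).map ofReal =
      B.map ofReal - (a : ℂ)⁻¹ • vecMulVec (fun i => (c i : ℂ)) (fun i => (c i : ℂ)) := by
    ext i j
    simp [vecMulVec_apply]
  have ha' : (a : ℂ) ≠ 0 := by exact_mod_cast ha.ne'
  rw [gaussTerm, gaussTerm, ← Complex.exp_add, ← Complex.exp_add, hM, dotProduct_schur_mulVec,
    add_dotProduct, smul_dotProduct, smul_eq_mul]
  congr 1
  field_simp
  ring_nf
  simp only [I_sq]
  ring

open Complex in
theorem gaussDualTerm_borderedMatrix {α : Type*} [Fintype α] [DecidableEq α] {a : ℝ} {c : α → ℝ}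
    {B : Matrix α α ℝ} (h : (borderedMatrix a c B).PosDef) (b₀ : ℂ) (b : α → ℂ) (s : ℤ)
    (m : α → ℤ) :
    gaussDualTerm (borderedMatrix a c B) (Sum.elim (fun _ => b₀) b) (Sum.elim (fun _ => s) m) =
      cexp (-Real.pi / a * (s + I * b₀) ^ 2) *
        gaussDualTerm (B - a⁻¹ • vecMulVec c c)
          (b + (I * (s + I * b₀) / a) • fun i => (c i : ℂ)) m := by
  obtain ⟨ha, hS⟩ := posDef_schur_of_posDef_borderedMatrix h
  have hM : (borderedMatrix a c B).map ofReal =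
      borderedMatrix (a : ℂ) (fun i => (c i : ℂ)) (B.map ofReal) := by
    ext (i | i) (j | j) <;> rfl
  have hM' : (B - a⁻¹ • vecMulVec c c).map ofReal =
      B.map ofReal - (a : ℂ)⁻¹ • vecMulVec (fun i => (c i : ℂ)) (fun i => (c i : ℂ)) := by
    ext i j
    simp [vecMulVec_apply]
  have hx : (fun i => ((Sum.elim (fun _ : Unit => s) m i : ℤ) : ℂ) +
        I * Sum.elim (fun _ : Unit => b₀) b i) =
      Sum.elim (fun _ => (s : ℂ) + I * b₀) (fun i => (m i : ℂ) + I * b i) := by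
    ext (i | i) <;> rfl
  have ha' : (a : ℂ) ≠ 0 := by exact_mod_cast ha.ne'
  have hu : IsUnit (B.map ofReal - (a : ℂ)⁻¹ •
      vecMulVec (fun i => (c i : ℂ)) (fun i => (c i : ℂ))).det := by
    rw [← hM']
    have := ((isUnit_iff_isUnit_det _).1 hS.isUnit).map Complex.ofRealHom
    rwa [RingHom.map_det] at this
  rw [gaussDualTerm, gaussDualTerm, ← Complex.exp_add, map_inv_ofReal h.isUnit,
    map_inv_ofReal hS.isUnit, hM, hM', hx, inv_borderedMatrix_mulVec ha' _ _ hu]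
  have hv : (fun i => (m i : ℂ) + I * (b + (I * (s + I * b₀) / a) • fun i => (c i : ℂ)) i) =
      (fun i => (m i : ℂ) + I * b i) - ((s + I * b₀) / a) • fun i => (c i : ℂ) := by
    ext i
    simp only [Pi.add_apply, Pi.sub_apply, Pi.smul_apply, smul_eq_mul]
    linear_combination ((s + I * b₀) / a * c i) * I_sq
  rw [hv]
  congr 1
  ring

open Complex in
/-- The Poisson summation formula for the Gaussian with matrix `A` and linear part `b`. -/
def GaussianPoisson {α : Type*} [Fintype α] [DecidableEq α] (A : Matrix α α ℝ) (b : α → ℂ) : Prop :=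
  ∑' x, gaussTerm A b x = 1 / ((A.det ^ (1 / 2 : ℝ) : ℝ) : ℂ) * ∑' m, gaussDualTerm A b m

theorem tsum_unit_sum_arrow {α : Type*} (f : (Unit ⊕ α → ℤ) → ℂ) :
    ∑' x, f x = ∑' p : ℤ × (α → ℤ), f (Sum.elim (fun _ => p.1) p.2) := by
  let e : ℤ × (α → ℤ) ≃ (Unit ⊕ α → ℤ) :=
    ((Equiv.funUnique Unit ℤ).symm.prodCongr (Equiv.refl _)).trans
      (Equiv.sumArrowEquivProdArrow Unit α ℤ).symm
  exact (e.tsum_eq f).symm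

theorem summable_unit_sum_arrow {α : Type*} {f : (Unit ⊕ α → ℤ) → ℂ} (hf : Summable f) :
    Summable fun p : ℤ × (α → ℤ) => f (Sum.elim (fun _ => p.1) p.2) := by
  let e : ℤ × (α → ℤ) ≃ (Unit ⊕ α → ℤ) :=
    ((Equiv.funUnique Unit ℤ).symm.prodCongr (Equiv.refl _)).trans
      (Equiv.sumArrowEquivProdArrow Unit α ℤ).symm
  exact e.summable_iff.2 hf

open Complex in
theorem summable_cexp_mul_gaussTerm {α : Type*} [Fintype α] {a : ℝ} (ha : 0 < a) (c : α → ℝ)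
    {S : Matrix α α ℝ} (hS : S.PosDef) (b₀ : ℂ) (b : α → ℂ) :
    Summable fun p : ℤ × (α → ℤ) => cexp (-Real.pi / a * (p.1 + I * b₀) ^ 2) *
      gaussTerm S (b + (I * (p.1 + I * b₀) / a) • fun i => (c i : ℂ)) p.2 := by
  have h1 : Summable fun s : ℤ => cexp (-Real.pi / a * (s + I * b₀) ^ 2) := by
    refine ((summable_cexp_neg_quadratic (inv_pos.2 ha) (-I * b₀ / a)).mul_left
      (cexp (Real.pi / a * b₀ ^ 2))).congr fun s => ?_
    rw [← Complex.exp_add]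
    congr 1
    push_cast
    linear_combination (Real.pi / a * b₀ ^ 2) * I_sq
  have h2 := (summable_gaussTerm hS (b + (-b₀ / a) • fun i => (c i : ℂ)))
  refine .of_norm ((h1.norm.mul_of_nonneg h2.norm (fun _ => norm_nonneg _)
    fun _ => norm_nonneg _).congr fun p => ?_)
  rw [norm_mul, norm_gaussTerm, norm_gaussTerm]
  congr 4
  refine congrArg (· ⬝ᵥ _) (funext fun i => ?_)
  simp [Complex.div_re, Complex.mul_re, Complex.mul_im]

theorem gaussianPoisson_borderedMatrix {α : Type*} [Fintype α] [DecidableEq α]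
    (ih : ∀ (A : Matrix α α ℝ), A.PosDef → ∀ b, GaussianPoisson A b)
    {a : ℝ} {c : α → ℝ} {B : Matrix α α ℝ} (h : (borderedMatrix a c B).PosDef) (b₀ : ℂ)
    (b : α → ℂ) : GaussianPoisson (borderedMatrix a c B) (Sum.elim (fun _ => b₀) b) := by
  obtain ⟨ha, hS⟩ := posDef_schur_of_posDef_borderedMatrix h
  have hjoint := summable_cexp_mul_gaussTerm ha c hS b₀ b
  have hsum := summable_unit_sum_arrow
    (summable_gaussTerm h (Sum.elim (fun _ => b₀) b))
  have hsum' := summable_unit_sum_arrow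
    (summable_gaussDualTerm h (Sum.elim (fun _ => b₀) b))
  have hre : 0 < ((a : ℝ) : ℂ).re := by simpa using ha
  have hdet : ((((borderedMatrix a c B).det ^ (1 / 2 : ℝ) : ℝ)) : ℂ) =
      (a : ℂ) ^ (1 / 2 : ℂ) * (((B - a⁻¹ • vecMulVec c c).det ^ (1 / 2 : ℝ) : ℝ) : ℂ) := by
    rw [det_borderedMatrix ha.ne', Real.mul_rpow ha.le hS.det_pos.le, Complex.ofReal_mul,
      Complex.ofReal_cpow ha.le]
    norm_num
  let b' : ℤ → α → ℂ := fun s => b + (Complex.I * (s + Complex.I * b₀) / a) • fun i => (c i : ℂ)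
  let g : ℤ → ℂ := fun s => Complex.exp (-Real.pi / a * (s + Complex.I * b₀) ^ 2)
  have hinner (y : α → ℤ) : ∑' t : ℤ, gaussTerm (borderedMatrix a c B) (Sum.elim (fun _ => b₀) b)
      (Sum.elim (fun _ => t) y) = 1 / (a : ℂ) ^ (1 / 2 : ℂ) *
        ∑' s : ℤ, g s * gaussTerm (B - a⁻¹ • vecMulVec c c) (b' s) y := by
    simp only [gaussTerm_borderedMatrix]
    rw [tsum_mul_right, Complex.tsum_exp_neg_quadratic hre, mul_assoc, ← tsum_mul_right]
    simp only [cexp_mul_gaussTerm_eq_schur ha, g, b']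
  have hIH (s : ℤ) : ∑' y, g s * gaussTerm (B - a⁻¹ • vecMulVec c c) (b' s) y =
      1 / (((B - a⁻¹ • vecMulVec c c).det ^ (1 / 2 : ℝ) : ℝ) : ℂ) *
        ∑' m, gaussDualTerm (borderedMatrix a c B) (Sum.elim (fun _ => b₀) b)
          (Sum.elim (fun _ => s) m) := by
    have h1 : ∑' y, gaussTerm (B - a⁻¹ • vecMulVec c c) (b' s) y = _ := ih _ hS (b' s)
    simp only [gaussDualTerm_borderedMatrix h]
    rw [tsum_mul_left, tsum_mul_left, h1]
    ring
  calc ∑' x, gaussTerm (borderedMatrix a c B) (Sum.elim (fun _ => b₀) b) x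
      = ∑' (t : ℤ) (y : α → ℤ), gaussTerm (borderedMatrix a c B) (Sum.elim (fun _ => b₀) b)
          (Sum.elim (fun _ => t) y) := by rw [tsum_unit_sum_arrow, hsum.tsum_prod]
    _ = ∑' (y : α → ℤ) (t : ℤ), gaussTerm (borderedMatrix a c B) (Sum.elim (fun _ => b₀) b)
          (Sum.elim (fun _ => t) y) := (Summable.tsum_comm hsum).symm
    _ = 1 / (a : ℂ) ^ (1 / 2 : ℂ) *
          ∑' (y : α → ℤ) (s : ℤ), g s * gaussTerm (B - a⁻¹ • vecMulVec c c) (b' s) y := by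
        simp only [hinner, tsum_mul_left]
    _ = 1 / (a : ℂ) ^ (1 / 2 : ℂ) *
          ∑' (s : ℤ) (y : α → ℤ), g s * gaussTerm (B - a⁻¹ • vecMulVec c c) (b' s) y := by
        congr 1
        exact Summable.tsum_comm
          (f := fun (s : ℤ) (y : α → ℤ) => g s * gaussTerm (B - a⁻¹ • vecMulVec c c) (b' s) y)
          hjoint
    _ = _ := by
        rw [tsum_congr hIH, tsum_mul_left, hdet, tsum_unit_sum_arrow (gaussDualTerm _ _),
          hsum'.tsum_prod]
        ring

theorem gaussianPoisson_of_equiv {α β : Type*} [Fintype α] [DecidableEq α] [Fintype β]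
    [DecidableEq β] (e : α ≃ β) (ih : ∀ (A : Matrix α α ℝ), A.PosDef → ∀ b, GaussianPoisson A b)
    {A : Matrix β β ℝ} (hA : A.PosDef) (b : β → ℂ) : GaussianPoisson A b := by
  have h := ih (A.submatrix e e) (hA.submatrix e.injective) (b ∘ e)
  rw [GaussianPoisson, det_submatrix_equiv_self,
    ← (e.symm.arrowCongr (Equiv.refl ℤ)).tsum_eq,
    ← (e.symm.arrowCongr (Equiv.refl ℤ)).tsum_eq (gaussDualTerm _ _)] at h
  have h1 (z w : β → ℂ) : (z ∘ e) ⬝ᵥ (w ∘ e) = z ⬝ᵥ w := comp_equiv_dotProduct_comp_equiv _ _ e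
  have h2 (M : Matrix β β ℝ) (z : β → ℂ) :
      (M.submatrix e e).map Complex.ofReal *ᵥ (z ∘ e) = (M.map Complex.ofReal *ᵥ z) ∘ e := by
    rw [← submatrix_map, submatrix_mulVec_equiv]
    simp [Function.comp_assoc]
  rw [GaussianPoisson]
  convert! h using 1
  · refine tsum_congr fun x => ?_
    have hx : (fun i => ((e.symm.arrowCongr (Equiv.refl ℤ) x i : ℤ) : ℂ)) =
      (fun i => (x i : ℂ)) ∘ e := rfl
    rw [gaussTerm, gaussTerm, hx, h2, h1, h1]
  · congr 1
    refine tsum_congr fun x => ?_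
    have hx : (fun i => ((e.symm.arrowCongr (Equiv.refl ℤ) x i : ℤ) : ℂ) +
      Complex.I * (b ∘ e) i) = (fun i => (x i : ℂ) + Complex.I * b i) ∘ e := rfl
    rw [gaussDualTerm, gaussDualTerm, hx, inv_submatrix_equiv, h2, h1]

theorem Matrix.PosDef.gaussianPoisson {α : Type*} [Fintype α] [DecidableEq α] {A : Matrix α α ℝ}
    (hA : A.PosDef) (b : α → ℂ) : GaussianPoisson A b := by
  suffices H : ∀ [Fintype α] [DecidableEq α] (A : Matrix α α ℝ), A.PosDef →
    ∀ b, GaussianPoisson A b from H A hA b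
  clear hA b A
  refine Finite.induction_empty_option (P := fun α => ∀ [Fintype α] [DecidableEq α]
    (A : Matrix α α ℝ), A.PosDef → ∀ b, GaussianPoisson A b) ?_ ?_ ?_ α
  · intro α β e ih _ _ A hA b
    classical
    let : Fintype α := Fintype.ofEquiv β e.symm
    exact gaussianPoisson_of_equiv e ih hA b
  · intro _ _ A hA b
    simp [GaussianPoisson, gaussTerm, gaussDualTerm]
  · intro α _ ih _ _ A hA b
    classical
    let e : Unit ⊕ α ≃ Option α := (Equiv.sumComm _ _).trans (Equiv.optionEquivSumPUnit α).symm
    refine gaussianPoisson_of_equiv e (fun A hA b => ?_) hA b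
    have hAe : A = borderedMatrix (A (.inl ()) (.inl ())) (fun j => A (.inl ()) (.inr j))
        A.toBlocks₂₂ := by
      ext (i | i) (j | j)
      · rfl
      · rfl
      · exact (hA.isHermitian.apply (Sum.inr i) (Sum.inl j)).symm
      · rfl
    have hbe : b = Sum.elim (fun _ => b (.inl ())) (fun i => b (.inr i)) := by
      ext (i | i) <;> rfl
    rw [hAe] at hA ⊢
    rw [hbe]
    exact gaussianPoisson_borderedMatrix ih hA _ _

theorem lap_eq_sum {N : ℕ} (hN : 2 ≤ N) (i j : Torus N) :
    lap N i j = (if i + (1, 0) = j then 1 else 0) + (if i + (-1, 0) = j then 1 else 0) +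
      (if i + (0, 1) = j then 1 else 0) + (if i + (0, -1) = j then 1 else 0) -
      4 * (if i = j then 1 else 0) := by
  have : Fact (1 < N) := ⟨hN⟩
  have key (s : Torus N) : s = j - i ↔ i + s = j := by rw [eq_sub_iff_add_eq, add_comm]
  by_cases h : i = j
  · subst h
    simp [lap]
  · simp only [lap, h, torusSteps, List.count_cons, List.count_nil, beq_iff_eq, key, if_false]
    push_cast
    ring

/-- The Dirichlet energy of a real function on the torus. -/
noncomputable def torusEnergy (N : ℕ) [NeZero N] (f : Torus N → ℝ) : ℝ :=
  ∑ i : Torus N, ((f (i + (1, 0)) - f i) ^ 2 + (f (i + (0, 1)) - f i) ^ 2)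

theorem sum_lap_mul {N : ℕ} [NeZero N] (hN : 2 ≤ N) (f : Torus N → ℝ) :
    ∑ i, ∑ j, f i * (lap N i j * f j) = -torusEnergy N f := by
  have h1 (i : Torus N) : ∑ j, f i * (lap N i j * f j) =
      f i * f (i + (1, 0)) + f i * f (i + (-1, 0)) + f i * f (i + (0, 1)) +
        f i * f (i + (0, -1)) - 4 * f i ^ 2 := by
    rw [← Finset.mul_sum]
    simp only [lap_eq_sum hN, add_mul, sub_mul, Finset.sum_add_distrib, Finset.sum_sub_distrib,
      ite_mul, one_mul, zero_mul, mul_ite, mul_one, mul_zero, Finset.sum_ite_eq, Finset.mem_univ,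
      if_true]
    ring
  have h2 (s : Torus N) : ∑ i, f (i + s) ^ 2 = ∑ i, f i ^ 2 :=
    Equiv.sum_comp (Equiv.addRight s) fun i => f i ^ 2
  have h3 (s : Torus N) : ∑ i, f i * f (i + -s) = ∑ i, f i * f (i + s) := by
    rw [← Equiv.sum_comp (Equiv.addRight s)]
    simp [mul_comm]
  have e1 : ((-1, 0) : Torus N) = -(1, 0) := by simp
  have e2 : ((0, -1) : Torus N) = -(0, 1) := by simp
  simp only [h1, torusEnergy, sub_sq, Finset.sum_add_distrib, Finset.sum_sub_distrib, h2, e1, e2, h3,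
    ← Finset.mul_sum]
  have h4 (s : Torus N) : ∑ i, 2 * f (i + s) * f i = 2 * ∑ i, f i * f (i + s) := by
    rw [Finset.mul_sum]
    exact Finset.sum_congr rfl fun i _ => by ring
  rw [h4, h4]
  ring

theorem eq_of_torusEnergy_eq_zero {N : ℕ} [NeZero N] {f : Torus N → ℝ} (h : torusEnergy N f = 0)
    (i : Torus N) : f i = f 0 := by
  have h0 := (Finset.sum_eq_zero_iff_of_nonneg fun i _ => by positivity).1 h
  have hx (i : Torus N) : f (i + (1, 0)) = f i := by
    have := h0 i (Finset.mem_univ i)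
    nlinarith [sq_nonneg (f (i + (1, 0)) - f i), sq_nonneg (f (i + (0, 1)) - f i)]
  have hy (i : Torus N) : f (i + (0, 1)) = f i := by
    have := h0 i (Finset.mem_univ i)
    nlinarith [sq_nonneg (f (i + (1, 0)) - f i), sq_nonneg (f (i + (0, 1)) - f i)]
  have hx' (k : ℕ) (b : ZMod N) : f (k, b) = f (0, b) := by
    induction k with
    | zero => simp
    | succ k ih => simpa [ih] using hx (k, b)
  have hy' (k : ℕ) : f (0, k) = f 0 := by
    induction k with
    | zero => rw [Nat.cast_zero, Prod.mk_zero_zero]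
    | succ k ih => simpa [ih] using hy (0, k)
  obtain ⟨a, b⟩ := i
  rw [← ZMod.natCast_zmod_val a, ← ZMod.natCast_zmod_val b, hx', hy']

/-- The torus Laplacian with the origin removed. -/
noncomputable def pinnedLap (N : ℕ) : Matrix {v : Torus N // v ≠ 0} {v : Torus N // v ≠ 0} ℝ :=
  fun i j => lap N i j

/-- Functions on the torus vanishing at the origin, as functions off the origin. -/
def pinnedEquiv (N : ℕ) (R : Type*) [Zero R] :
    {f : Torus N → R // f 0 = 0} ≃ ({v : Torus N // v ≠ 0} → R) where
  toFun f v := f.1 v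
  invFun g := ⟨fun v => if h : v ≠ 0 then g ⟨v, h⟩ else 0, by simp⟩
  left_inv f := by
    ext v
    by_cases h : v = 0
    · simp [h, f.2]
    · simp [h]
  right_inv g := by
    ext v
    simp [v.2]

theorem dotProduct_pinnedLap_mulVec {N : ℕ} [NeZero N] (hN : 2 ≤ N) {f : Torus N → ℝ}
    (hf : f 0 = 0) :
    (fun v : {v : Torus N // v ≠ 0} => f v) ⬝ᵥ pinnedLap N *ᵥ (fun v => f v) =
      -torusEnergy N f := by
  rw [← sum_lap_mul hN]
  have h (g : Torus N → ℝ) (hg : g 0 = 0) : ∑ v : {v : Torus N // v ≠ 0}, g v = ∑ v, g v := by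
    rw [← Fintype.sum_subtype_add_sum_subtype (· ≠ 0) g, left_eq_add]
    exact Finset.sum_eq_zero fun v _ => by rw [not_not.1 v.2, hg]
  simp only [dotProduct, mulVec, pinnedLap]
  rw [← h _ (by simp [hf])]
  refine Finset.sum_congr rfl fun i _ => ?_
  rw [Finset.mul_sum]
  exact h (fun j => f i * (lap N i j * f j)) (by simp [hf])

theorem posDef_neg_pinnedLap {N : ℕ} [NeZero N] (hN : 2 ≤ N) : (-pinnedLap N).PosDef := by
  refine .of_dotProduct_mulVec_pos ?_ fun x hx => ?_
  · ext i j
    have e (s : Torus N) : (j : Torus N) + s = i ↔ (i : Torus N) + -s = j := by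
      rw [← sub_eq_add_neg, sub_eq_iff_eq_add, eq_comm]
    simp only [conjTranspose_apply, Matrix.neg_apply, star_trivial, pinnedLap, lap_eq_sum hN, e,
      Prod.neg_mk, neg_zero, neg_neg, @eq_comm _ (j : Torus N) i]
    ring
  · obtain ⟨⟨f, hf⟩, rfl⟩ := (pinnedEquiv N ℝ).surjective x
    have h := dotProduct_pinnedLap_mulVec hN hf
    change 0 < star (fun v : {v : Torus N // v ≠ 0} => f v) ⬝ᵥ -pinnedLap N *ᵥ (fun v => f v)
    rw [star_trivial, neg_mulVec, dotProduct_neg, h, neg_neg]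
    refine lt_of_le_of_ne (Finset.sum_nonneg fun i _ => by positivity) fun h0 => hx ?_
    ext v
    exact (eq_of_torusEnergy_eq_zero h0.symm v).trans hf

theorem Matrix.PosDef.tsum_exp_neg_quadratic {α : Type*} [Fintype α] [DecidableEq α]
    {A : Matrix α α ℝ} (hA : A.PosDef) {β : ℝ} (hβ : 0 < β) :
    ∑' x : α → ℤ, Real.exp (-β * ((fun i => (x i : ℝ)) ⬝ᵥ A *ᵥ (fun i => (x i : ℝ)))) =
      (Real.pi / β) ^ ((Fintype.card α : ℝ) / 2) * A.det ^ (-(1 / 2) : ℝ) *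
        ∑' m : α → ℤ, Real.exp (-(4 * β)⁻¹ * ((fun i => 2 * Real.pi * (m i : ℝ)) ⬝ᵥ
          A⁻¹ *ᵥ (fun i => 2 * Real.pi * (m i : ℝ)))) := by
  have hβπ : 0 < β / Real.pi := by positivity
  have h : GaussianPoisson _ _ := (hA.smul hβπ).gaussianPoisson 0
  have hquad (B : Matrix α α ℝ) (x : α → ℤ) :
      (fun i => (x i : ℂ)) ⬝ᵥ B.map Complex.ofReal *ᵥ (fun i => (x i : ℂ)) =
      (((fun i => (x i : ℝ)) ⬝ᵥ B *ᵥ (fun i => (x i : ℝ)) : ℝ) : ℂ) := by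
    simp [dotProduct, mulVec]
  have hl (x : α → ℤ) : gaussTerm ((β / Real.pi) • A) 0 x =
      ((Real.exp (-β * ((fun i => (x i : ℝ)) ⬝ᵥ A *ᵥ (fun i => (x i : ℝ)))) : ℝ) : ℂ) := by
    rw [gaussTerm, hquad, smul_mulVec, dotProduct_smul, Complex.ofReal_exp]
    congr 1
    push_cast
    have := Complex.ofReal_ne_zero.2 Real.pi_ne_zero
    simp
    field_simp
  have hinv : ((β / Real.pi) • A)⁻¹ = (Real.pi / β) • A⁻¹ := by
    have := inv_smul' A (Units.mk0 _ hβπ.ne') ((isUnit_iff_isUnit_det A).1 hA.isUnit)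
    rw [Units.smul_def, Units.smul_def] at this
    simpa using this
  have hr (m : α → ℤ) : gaussDualTerm ((β / Real.pi) • A) 0 m =
      ((Real.exp (-(4 * β)⁻¹ * ((fun i => 2 * Real.pi * (m i : ℝ)) ⬝ᵥ
          A⁻¹ *ᵥ (fun i => 2 * Real.pi * (m i : ℝ)))) : ℝ) : ℂ) := by
    have hm : (fun i => 2 * Real.pi * (m i : ℝ)) = (2 * Real.pi) • fun i => (m i : ℝ) := rfl
    rw [gaussDualTerm, hinv, hm]
    simp only [Pi.zero_apply, mul_zero, add_zero]
    rw [hquad, ← Complex.ofReal_neg, ← Complex.ofReal_mul, ← Complex.ofReal_exp]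
    congr 2
    simp only [smul_mulVec, mulVec_smul, dotProduct_smul, smul_dotProduct, smul_eq_mul]
    field_simp
    ring
  have hdet : 1 / ((β / Real.pi) • A).det ^ (1 / 2 : ℝ) =
      (Real.pi / β) ^ ((Fintype.card α : ℝ) / 2) * A.det ^ (-(1 / 2) : ℝ) := by
    rw [det_smul, Real.mul_rpow (by positivity) hA.det_pos.le, Real.rpow_neg hA.det_pos.le,
      ← inv_div β, Real.inv_rpow hβπ.le, ← Real.rpow_natCast, ← Real.rpow_mul hβπ.le,
      one_div, mul_inv, mul_one_div]
  rw [GaussianPoisson] at h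
  simp only [hl, hr] at h
  rw [← hdet]
  exact_mod_cast h

/-- Duality between the discrete Gaussian model pinned at the origin and the lattice
Coulomb gas: with `β* = (4β)⁻¹`,
`∑_{x∈Ω_Λ} e^{−βH_Λ(x)} = (π/β)^{(|Λ|−1)/2} det(−Δ_{0ᶜ0ᶜ})^{−1/2}
  ∑_{k∈2πℤ^{Λ∖{0}}} e^{β* kᵀ(Δ_{0ᶜ0ᶜ})⁻¹k}`. -/
theorem stmt10 (N : ℕ) [NeZero N] (hN : 2 ≤ N) (β : ℝ) (hβ : 0 < β) :
    let Δ0 : Matrix {v : Torus N // v ≠ 0} {v : Torus N // v ≠ 0} ℝ :=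
      fun i j => lap N (i : Torus N) (j : Torus N)
    (∑' x : {f : Torus N → ℤ // f 0 = 0}, Real.exp (-β * dgHam N x.1))
      = (Real.pi / β) ^ (((N ^ 2 : ℝ) - 1) / 2) * (-Δ0).det ^ (-(1 / 2) : ℝ) *
        ∑' m : {v : Torus N // v ≠ 0} → ℤ,
          Real.exp ((4 * β)⁻¹ *
            ((fun i => 2 * Real.pi * (m i : ℝ)) ⬝ᵥ
              Δ0⁻¹.mulVec (fun i => 2 * Real.pi * (m i : ℝ)))) := by
  intro Δ0
  have hΔ : Δ0 = pinnedLap N := rfl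
  have hcard : (Fintype.card {v : Torus N // v ≠ 0} : ℝ) = (N ^ 2 : ℝ) - 1 := by
    rw [Fintype.card_subtype_compl, Fintype.card_subtype_eq, Fintype.card_prod, ZMod.card,
      Nat.cast_sub (Nat.mul_pos (by omega) (by omega))]
    push_cast
    ring
  have h := (posDef_neg_pinnedLap hN).tsum_exp_neg_quadratic hβ
  have hdet : IsUnit (pinnedLap N).det :=
    (isUnit_iff_isUnit_det _).1 (by simpa using (posDef_neg_pinnedLap hN).isUnit.neg)
  have hinv : (-pinnedLap N)⁻¹ = -(pinnedLap N)⁻¹ :=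
    inv_eq_left_inv (by rw [neg_mul_neg, nonsing_inv_mul _ hdet])
  rw [hcard, hinv] at h
  rw [hΔ, ← (pinnedEquiv N ℤ).symm.tsum_eq]
  simp only [neg_mulVec, dotProduct_neg, neg_mul_neg] at h
  rw [← h]
  refine tsum_congr fun x => ?_
  obtain ⟨⟨f, hf⟩, rfl⟩ := (pinnedEquiv N ℤ).surjective x
  rw [Equiv.symm_apply_apply]
  have hq := dotProduct_pinnedLap_mulVec hN (f := fun v => (f v : ℝ)) (by simp [hf])
  change _ = Real.exp (β * ((fun v : {v : Torus N // v ≠ 0} => (f v : ℝ)) ⬝ᵥ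
    pinnedLap N *ᵥ (fun v => (f v : ℝ))))
  rw [hq, mul_neg, neg_mul, dgHam, torusEnergy]
  push_cast
  rfl
end

section
/- For all β ≥ 3 and all N×N torus boxes Λ with N ≥ 4 and all i,j ∈ Λ, the discrete Gaussian measure P_{Λ,β} satisfies P_{Λ,β}(|x_i − x_j| ≥ k) ≤ 2φ(β)ᵏ for every k ∈ ℕ, where φ(β) = 480(3e^{−β})⁴. -/
open Matrix Filter

namespace DiscreteGaussian

/-! ### Sums over unions and orbits of permutations -/

lemma sum_biUnion_le_sum {ι α : Type*} [DecidableEq α] (s : Finset ι) (t : ι → Finset α)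
    (f : α → ℝ) (hf : ∀ a, 0 ≤ f a) :
    ∑ a ∈ s.biUnion t, f a ≤ ∑ i ∈ s, ∑ a ∈ t i, f a := by
  classical
  induction s using Finset.induction_on with
  | empty => simp
  | insert i s hi ih =>
    rw [Finset.biUnion_insert, Finset.sum_insert hi]
    have h := Finset.sum_union_inter (s₁ := t i) (s₂ := s.biUnion t) (f := f)
    have h' : 0 ≤ ∑ a ∈ t i ∩ s.biUnion t, f a := Finset.sum_nonneg fun a _ => hf a
    linarith

section Orbit

variable {α : Type*} [DecidableEq α]

/-- The vertex sets of walks with `n` steps from `p` whose steps are taken from the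
family of maps `m`. -/
def traces {τ : Type*} [Fintype τ] (m : τ → α → α) : ℕ → α → Finset (Finset α)
  | 0, p => {{p}}
  | n + 1, p => Finset.univ.biUnion fun t => (traces m n (m t p)).image (insert p)

lemma card_traces_le {τ : Type*} [Fintype τ] (m : τ → α → α) (n : ℕ) (p : α) :
    (traces m n p).card ≤ Fintype.card τ ^ n := by
  induction n generalizing p with
  | zero => simp [traces]
  | succ n ih =>
    refine Finset.card_biUnion_le.trans ?_
    calc ∑ t : τ, ((traces m n (m t p)).image (insert p)).card
        ≤ ∑ _t : τ, Fintype.card τ ^ n :=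
          Finset.sum_le_sum fun t _ => Finset.card_image_le.trans (ih _)
      _ = Fintype.card τ ^ (n + 1) := by simp [pow_succ']

lemma image_range_mem_traces {τ : Type*} [Fintype τ] (m : τ → α → α) (σ : Equiv.Perm α)
    (n : ℕ) (p : α) (h : ∀ k, ∃ t, σ ((σ ^ k) p) = m t ((σ ^ k) p)) :
    (Finset.range (n + 1)).image (fun k => (σ ^ k) p) ∈ traces m n p := by
  induction n generalizing p with
  | zero => simp [traces]
  | succ n ih =>
    obtain ⟨t, ht⟩ := h 0
    simp only [pow_zero, Equiv.Perm.one_apply] at ht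
    have hs : ∀ k, (σ ^ (k + 1)) p = (σ ^ k) (σ p) := fun k => by
      rw [pow_succ, Equiv.Perm.mul_apply]
    refine Finset.mem_biUnion.2 ⟨t, Finset.mem_univ t, Finset.mem_image.2 ⟨_, ih (m t p) ?_, ?_⟩⟩
    · intro k
      rw [← ht, ← hs]
      exact h (k + 1)
    · rw [Finset.range_add_one' (n := n + 1), Finset.image_insert, Finset.map_eq_image,
        Finset.image_image]
      congr 1
      refine Finset.image_congr fun k _ => ?_
      change (σ ^ k) (m t p) = (σ ^ (k + 1)) p
      rw [hs, ht]

variable [Fintype α]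

/-- The orbit of `p` under the permutation `σ`. -/
def orbit (σ : Equiv.Perm α) (p : α) : Finset α := Finset.univ.filter (σ.SameCycle p)

@[simp] lemma mem_orbit {σ : Equiv.Perm α} {p q : α} : q ∈ orbit σ p ↔ σ.SameCycle p q := by
  simp [orbit]

lemma self_mem_orbit (σ : Equiv.Perm α) (p : α) : p ∈ orbit σ p :=
  mem_orbit.2 (Equiv.Perm.SameCycle.refl σ p)

lemma orbit_eq {σ : Equiv.Perm α} {p q : α} (h : q ∈ orbit σ p) : orbit σ q = orbit σ p := by
  ext r
  rw [mem_orbit] at h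
  simpa using ⟨fun h' => h.trans h', fun h' => h.symm.trans h'⟩

lemma pow_apply_mem_orbit (σ : Equiv.Perm α) (n : ℕ) (p : α) : (σ ^ n) p ∈ orbit σ p :=
  mem_orbit.2 (Equiv.Perm.sameCycle_pow_right.2 (Equiv.Perm.SameCycle.refl σ p))

lemma isCycleOn_orbit (σ : Equiv.Perm α) (p : α) : σ.IsCycleOn (orbit σ p : Set α) := by
  refine ⟨⟨fun q hq => ?_, σ.injective.injOn, fun q hq => ⟨σ.symm q, ?_, by simp⟩⟩, ?_⟩
  · simpa using hq
  · simpa using hq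
  · intro q hq r hr
    simp only [Finset.mem_coe, mem_orbit] at hq hr
    exact hq.symm.trans hr

lemma orbit_eq_image (σ : Equiv.Perm α) (p : α) :
    orbit σ p = (Finset.range (orbit σ p).card).image (fun n => (σ ^ n) p) := by
  ext q
  constructor
  · intro hq
    obtain ⟨n, hn, rfl⟩ := (isCycleOn_orbit σ p).exists_pow_eq (self_mem_orbit σ p) hq
    exact Finset.mem_image.2 ⟨n, Finset.mem_range.2 hn, rfl⟩
  · intro hq
    obtain ⟨n, -, rfl⟩ := Finset.mem_image.1 hq
    exact pow_apply_mem_orbit σ n p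

lemma orbit_mem_traces {τ : Type*} [Fintype τ] (m : τ → α → α) (σ : Equiv.Perm α) (p : α)
    (h : ∀ q ∈ orbit σ p, ∃ t, σ q = m t q) :
    orbit σ p ∈ traces m ((orbit σ p).card - 1) p := by
  have hpos : 0 < (orbit σ p).card := Finset.card_pos.2 ⟨p, self_mem_orbit σ p⟩
  have := image_range_mem_traces m σ ((orbit σ p).card - 1) p fun k =>
    h _ (pow_apply_mem_orbit σ k p)
  rwa [Nat.sub_add_cancel hpos, ← orbit_eq_image] at this

end Orbit

/-! ### Boundaries of sets of sites and the contour-following permutation -/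

section Boundary

variable {N : ℕ}

/-- The unit steps of the torus in counterclockwise order. -/
def dir (N : ℕ) : Fin 4 → Torus N := ![(1, 0), (0, 1), (-1, 0), (0, -1)]

@[simp] lemma dir_zero : dir N 0 = (1, 0) := rfl
@[simp] lemma dir_one : dir N 1 = (0, 1) := rfl
@[simp] lemma dir_two : dir N 2 = (-1, 0) := rfl
@[simp] lemma dir_three : dir N 3 = (0, -1) := rfl

lemma dir_add_two (d : Fin 4) : dir N (d + 2) = -dir N d := by
  fin_cases d <;> simp [dir]

lemma dir_add_three (d : Fin 4) : dir N (d + 3) = -dir N (d + 1) := by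
  rw [← dir_add_two, add_assoc]
  rfl

/-- A dart of the torus: a site together with one of the four directions. -/
abbrev Dart (N : ℕ) := Torus N × Fin 4

/-- The dart of the same edge with the opposite orientation. -/
def rev (p : Dart N) : Dart N := (p.1 + dir N p.2, p.2 + 2)

/-- The signed indicator of a set of darts. -/
def flow (S : Finset (Dart N)) (p : Dart N) : ℤ :=
  (if p ∈ S then 1 else 0) - (if rev p ∈ S then 1 else 0)

lemma rev_rev (p : Dart N) : rev (rev p) = p := by
  obtain ⟨u, d⟩ := p
  have : d + 2 + 2 = d := by rw [add_assoc]; exact add_zero d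
  simp [rev, dir_add_two, this]

lemma flow_rev (S : Finset (Dart N)) (p : Dart N) : flow S (rev p) = -flow S p := by
  simp [flow, rev_rev]

variable [NeZero N]

/-- The darts leaving the set `E`. -/
def bdry (E : Finset (Torus N)) : Finset (Dart N) :=
  Finset.univ.filter fun p => p.1 ∈ E ∧ p.1 + dir N p.2 ∉ E

@[simp] lemma mem_bdry {E : Finset (Torus N)} {p : Dart N} :
    p ∈ bdry E ↔ p.1 ∈ E ∧ p.1 + dir N p.2 ∉ E := by
  simp [bdry]

omit [NeZero N] in
/-- The three possible continuations of a contour crossing the dart `p` with `p.1` on its left: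
turn left, go straight, turn right. -/
def move (t : Fin 3) (p : Dart N) : Dart N :=
  ![(p.1, p.2 + 1), (p.1 + dir N (p.2 + 1), p.2),
    (p.1 + dir N p.2 + dir N (p.2 + 1), p.2 + 3)] t

omit [NeZero N] in
/-- The continuation of the contour of `E` after the dart `p`. -/
def next (E : Finset (Torus N)) (p : Dart N) : Dart N :=
  if p.1 + dir N (p.2 + 1) ∉ E then (p.1, p.2 + 1)
  else if p.1 + dir N p.2 + dir N (p.2 + 1) ∉ E then (p.1 + dir N (p.2 + 1), p.2)
  else (p.1 + dir N p.2 + dir N (p.2 + 1), p.2 + 3)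

omit [NeZero N] in
/-- The predecessor of the dart `p` in the contour of `E`. -/
def prev (E : Finset (Torus N)) (p : Dart N) : Dart N :=
  if p.1 - dir N (p.2 + 1) ∉ E then (p.1, p.2 + 3)
  else if p.1 - dir N (p.2 + 1) + dir N p.2 ∉ E then (p.1 - dir N (p.2 + 1), p.2)
  else (p.1 - dir N (p.2 + 1) + dir N p.2, p.2 + 1)

omit [NeZero N] in
lemma exists_next_eq_move (E : Finset (Torus N)) (p : Dart N) : ∃ t, next E p = move t p := by
  unfold next
  split_ifs
  exacts [⟨2, rfl⟩, ⟨1, rfl⟩, ⟨0, rfl⟩]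

lemma next_mem_bdry {E : Finset (Torus N)} {p : Dart N} (hp : p ∈ bdry E) :
    next E p ∈ bdry E := by
  obtain ⟨u, d⟩ := p
  rw [mem_bdry] at hp
  unfold next
  split_ifs with h₁ h₂
  · simp_all [dir_add_three]
  · simp_all [add_right_comm]
  · simp_all

lemma prev_next {E : Finset (Torus N)} {p : Dart N} (hp : p ∈ bdry E) :
    prev E (next E p) = p := by
  obtain ⟨u, d⟩ := p
  rw [mem_bdry] at hp
  have e₁ : d + 1 + 1 = d + 2 := by rw [add_assoc]; rfl
  have e₂ : d + 1 + 3 = d := by rw [add_assoc]; exact add_zero d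
  have e₃ : d + 3 + 1 = d := by rw [add_assoc]; exact add_zero d
  unfold next
  split_ifs with h₁ h₂
  · have e₄ : u + dir N d + dir N (d + 1) - dir N d = u + dir N (d + 1) := by abel
    have e₅ : d + 3 + 3 = d + 2 := by rw [add_assoc]; rfl
    simp_all [prev, dir_add_three]
  · simp_all [prev]
  · simp_all [prev, dir_add_two]

/-- The permutation of the darts following the contours of `E`. -/
noncomputable def contourPerm (E : Finset (Torus N)) : Equiv.Perm (Dart N) :=
  Equiv.ofBijective (fun p => if p ∈ bdry E then next E p else p) <| by
    refine Finite.injective_iff_bijective.1 fun p q h => ?_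
    by_cases hp : p ∈ bdry E <;> by_cases hq : q ∈ bdry E <;>
      simp only [hp, hq, if_true, if_false] at h
    · rw [← prev_next hp, ← prev_next hq, h]
    · exact absurd (h ▸ next_mem_bdry hp) hq
    · exact absurd (h ▸ next_mem_bdry hq) hp
    · exact h

lemma contourPerm_apply {E : Finset (Torus N)} {p : Dart N} (hp : p ∈ bdry E) :
    contourPerm E p = next E p := by
  simp only [contourPerm, Equiv.ofBijective_apply, if_pos hp]

lemma contourPerm_pow_mem_bdry {E : Finset (Torus N)} {p : Dart N} (hp : p ∈ bdry E) (n : ℕ) :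
    (contourPerm E ^ n) p ∈ bdry E := by
  induction n with
  | zero => exact hp
  | succ n ih =>
    rw [pow_succ', Equiv.Perm.mul_apply, contourPerm_apply ih]
    exact next_mem_bdry ih

/-- The contour of `E` through the dart `p`. -/
noncomputable def contour (E : Finset (Torus N)) (p : Dart N) : Finset (Dart N) :=
  orbit (contourPerm E) p

lemma contour_subset_bdry {E : Finset (Torus N)} {p : Dart N} (hp : p ∈ bdry E) :
    contour E p ⊆ bdry E := by
  intro q hq
  rw [contour, orbit_eq_image] at hq
  obtain ⟨n, -, rfl⟩ := Finset.mem_image.1 hq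
  exact contourPerm_pow_mem_bdry hp n

lemma contour_mem_traces {E : Finset (Torus N)} {p : Dart N} (hp : p ∈ bdry E) :
    contour E p ∈ traces move ((contour E p).card - 1) p := by
  refine orbit_mem_traces move (contourPerm E) p fun q hq => ?_
  rw [contourPerm_apply (contour_subset_bdry hp hq)]
  exact exists_next_eq_move E q

lemma next_mem_contour_iff {E : Finset (Torus N)} {p q : Dart N} (hq : q ∈ bdry E) :
    next E q ∈ contour E p ↔ q ∈ contour E p := by
  rw [← contourPerm_apply hq, contour, mem_orbit, mem_orbit, Equiv.Perm.sameCycle_apply_right]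

lemma flow_closed {E : Finset (Torus N)} {S : Finset (Dart N)} (hS : S ⊆ bdry E)
    (hnext : ∀ q ∈ bdry E, (next E q ∈ S ↔ q ∈ S)) (u : Torus N) :
    flow S (u, 0) + flow S (u + (1, 0), 1) = flow S (u + (0, 1), 0) + flow S (u, 1) := by
  have h₁ := hnext (u, 0)
  have h₂ := hnext (u + (1, 0), 1)
  have h₃ := hnext (u + (1, 0) + (0, 1), 2)
  have h₄ := hnext (u + (0, 1), 3)
  have k₁ := @hS (u, 0)
  have k₂ := @hS (u + (1, 0), 1)
  have k₃ := @hS (u + (1, 0) + (0, 1), 2)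
  have k₄ := @hS (u + (0, 1), 3)
  have l₁ := @hS (u, 1)
  have l₂ := @hS (u + (1, 0), 2)
  have l₃ := @hS (u + (1, 0) + (0, 1), 3)
  have l₄ := @hS (u + (0, 1), 0)
  have e₁ : (1 : Fin 4) + 1 = 2 := rfl
  have e₂ : (2 : Fin 4) + 1 = 3 := rfl
  have e₃ : (3 : Fin 4) + 1 = 0 := rfl
  have e₄ : (1 : Fin 4) + 2 = 3 := rfl
  have e₅ : (1 : Fin 4) + 3 = 0 := rfl
  have e₆ : (2 : Fin 4) + 3 = 1 := rfl
  have e₇ : (3 : Fin 4) + 3 = 2 := rfl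
  have s₁ : u + (1, 0) + (-1, 0) = u := by ext <;> simp
  have s₂ : u + (1, 0) + (0, 1) + (-1, 0) = u + (0, 1) := by ext <;> simp
  have s₃ : u + (1, 0) + (0, 1) + (0, -1) = u + (1, 0) := by ext <;> simp
  have s₄ : u + (0, 1) + (0, -1) = u := by ext <;> simp
  have s₅ : u + (0, 1) + (1, 0) = u + (1, 0) + (0, 1) := add_right_comm _ _ _
  simp only [mem_bdry, next, dir_zero, dir_one, dir_two, dir_three, zero_add, e₁, e₂, e₃, e₅, e₆,
    e₇, s₁, s₂, s₃, s₄, s₅] at h₁ h₂ h₃ h₄ k₁ k₂ k₃ k₄ l₁ l₂ l₃ l₄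
  simp only [flow, rev, dir_zero, dir_one, zero_add, e₄, s₅]
  clear hnext hS
  by_cases hA : u ∈ E <;> by_cases hB : u + (1, 0) ∈ E <;>
    by_cases hC : u + (1, 0) + (0, 1) ∈ E <;> by_cases hD : u + (0, 1) ∈ E <;>
    simp_all
  ring

lemma exists_potential {a b : Torus N → ℤ}
    (hclosed : ∀ u, a u + b (u + (1, 0)) = a (u + (0, 1)) + b u) {r s : ZMod N}
    (ha : ∀ x, a (x, r) = 0) (hb : ∀ y, b (s, y) = 0) :
    ∃ h : Torus N → ℤ, ∀ u, h u - h (u + (1, 0)) = a u ∧ h u - h (u + (0, 1)) = b u := by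
  set g : ZMod N → ℕ → ℤ := fun x n => ∑ t ∈ Finset.range n, b (x, r + t) with hg
  have hg_step : ∀ x n, g (x + 1) n - g x n = a (x, r + n) := by
    intro x n
    induction n with
    | zero => simp [hg, ha]
    | succ n ih =>
      have h := hclosed (x, r + n)
      simp only [Prod.mk_add_mk, add_zero] at h
      simp only [hg, Finset.sum_range_succ] at ih ⊢
      push_cast
      rw [← add_assoc]
      linarith
  have hg_full : ∀ x, g x N = 0 := by
    have h : ∀ m : ℕ, g (s + m) N = 0 := by
      intro m
      induction m with
      | zero => simp [hg, hb]
      | succ m ih =>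
        have h := hg_step (s + m) N
        simp only [CharP.cast_eq_zero, add_zero, ha, ih, sub_zero] at h
        push_cast
        rw [← add_assoc]
        exact h
    intro x
    simpa using h (x - s).val
  refine ⟨fun u => -g u.1 (u.2 - r).val, ?_⟩
  rintro ⟨x, y⟩
  constructor
  · have h := hg_step x (y - r).val
    simp only [ZMod.natCast_val, ZMod.cast_id', id_eq, add_sub_cancel] at h
    simp only [Prod.mk_add_mk, add_zero]
    linarith
  · have hsucc : g x ((y - r).val + 1) = g x (y - r).val + b (x, y) := by
      simp [hg, Finset.sum_range_succ]
    have hval : g x (y + 1 - r).val = g x ((y - r).val + 1) := by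
      have hcast : y + 1 - r = (((y - r).val + 1 : ℕ) : ZMod N) := by
        push_cast
        rw [ZMod.natCast_zmod_val]
        ring
      rcases (Nat.succ_le_of_lt (ZMod.val_lt (y - r))).lt_or_eq with hlt | heq
      · rw [hcast, ZMod.val_cast_of_lt hlt]
      · simp only [Nat.succ_eq_add_one] at heq
        rw [hcast, heq, hg_full]
        simp [hg]
    simp only [Prod.mk_add_mk, add_zero]
    rw [hval, hsucc]
    ring

lemma exists_potential_of_flow {S : Finset (Dart N)}
    (hclosed : ∀ u, flow S (u, 0) + flow S (u + (1, 0), 1) =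
      flow S (u + (0, 1), 0) + flow S (u, 1))
    {r s : ZMod N} (hr : ∀ q ∈ S, q.1.2 ≠ r) (hs : ∀ q ∈ S, q.1.1 ≠ s) :
    ∃ h : Torus N → ℤ, ∀ p : Dart N, h p.1 - h (p.1 + dir N p.2) = flow S p := by
  have hr' : ∀ x, flow S ((x, r), 0) = 0 := fun x => by
    have h₁ : (((x, r), 0) : Dart N) ∉ S := fun h => hr _ h rfl
    have h₂ : rev (((x, r), 0) : Dart N) ∉ S := fun h => hr _ h (by simp [rev])
    simp [flow, h₁, h₂]
  have hs' : ∀ y, flow S ((s, y), 1) = 0 := fun y => by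
    have h₁ : (((s, y), 1) : Dart N) ∉ S := fun h => hs _ h rfl
    have h₂ : rev (((s, y), 1) : Dart N) ∉ S := fun h => hs _ h (by simp [rev])
    simp [flow, h₁, h₂]
  obtain ⟨h, hh⟩ := exists_potential (a := fun u => flow S (u, 0)) (b := fun u => flow S (u, 1))
    hclosed hr' hs'
  have hpos : ∀ u, h u - h (u + dir N 0) = flow S (u, 0) ∧ h u - h (u + dir N 1) = flow S (u, 1) :=
    hh
  have hneg : ∀ u : Torus N, ∀ d : Fin 4, h (u + dir N (d + 2)) -
      h (u + dir N (d + 2) + dir N d) = flow S (u + dir N (d + 2), d) →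
      h u - h (u + dir N (d + 2)) = flow S (u, d + 2) := by
    intro u d hd
    have e : ((u, d + 2) : Dart N) = rev (u + dir N (d + 2), d) := by
      simp [rev, dir_add_two]
    rw [e, flow_rev, ← hd, dir_add_two, neg_add_cancel_right]
    ring
  refine ⟨h, ?_⟩
  rintro ⟨u, d⟩
  fin_cases d
  · exact (hpos u).1
  · exact (hpos u).2
  · exact hneg u 0 (hpos _).1
  · exact hneg u 1 (hpos _).2

/-! ### Minimal cuts -/

/-- `E` separates `i` from `j`, and no separating set has a strictly smaller boundary. -/
def IsMinCut (i j : Torus N) (E : Finset (Torus N)) : Prop :=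
  i ∈ E ∧ j ∉ E ∧ ∀ F : Finset (Torus N), i ∈ F → j ∉ F → bdry F ⊆ bdry E → bdry E ⊆ bdry F

lemma exists_isMinCut {i j : Torus N} {D : Finset (Torus N)} (hi : i ∈ D) (hj : j ∉ D) :
    ∃ E, IsMinCut i j E ∧ bdry E ⊆ bdry D := by
  classical
  obtain ⟨E, hE, hmin⟩ := Finset.exists_min_image
    (Finset.univ.filter fun F : Finset (Torus N) => i ∈ F ∧ j ∉ F ∧ bdry F ⊆ bdry D)
    (fun F => (bdry F).card) ⟨D, by simp [hi, hj]⟩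
  simp only [Finset.mem_filter, Finset.mem_univ, true_and] at hE hmin
  refine ⟨E, ⟨hE.1, hE.2.1, fun F hiF hjF hF => ?_⟩, hE.2.2⟩
  exact (Finset.eq_of_subset_of_card_le hF (hmin F ⟨hiF, hjF, hF.trans hE.2.2⟩)).superset

lemma IsMinCut.bdry_subset_of_potential {i j : Torus N} {E : Finset (Torus N)}
    (hE : IsMinCut i j E) {T : Finset (Dart N)} (hT : T ⊆ bdry E) {h : Torus N → ℤ}
    (hij : h j < h i) (hh : ∀ p : Dart N, h (p.1 + dir N p.2) < h p.1 → p ∈ T) :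
    bdry E ⊆ T := by
  have hF : bdry (Finset.univ.filter fun u => h i ≤ h u) ⊆ T := by
    intro p hp
    simp only [mem_bdry, Finset.mem_filter, Finset.mem_univ, true_and, not_le] at hp
    exact hh p (hp.2.trans_le hp.1)
  exact (hE.2.2 _ (by simp) (by simpa using hij) (hF.trans hT)).trans hF

lemma IsMinCut.contour_eq_bdry {i j : Torus N} {E : Finset (Torus N)} (hE : IsMinCut i j E)
    {p : Dart N} (hp : p ∈ bdry E) {r s : ZMod N} (hr : ∀ q ∈ contour E p, q.1.2 ≠ r)
    (hs : ∀ q ∈ contour E p, q.1.1 ≠ s) : contour E p = bdry E := by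
  have hsub := contour_subset_bdry hp
  obtain ⟨h, hh⟩ := exists_potential_of_flow
    (flow_closed hsub fun q hq => next_mem_contour_iff hq) hr hs
  refine hsub.antisymm ?_
  rcases lt_or_ge (h j) (h i) with hij | hij
  · refine hE.bdry_subset_of_potential hsub hij fun q hq => ?_
    have hq' := hh q
    by_contra hmem
    rw [flow, if_neg hmem] at hq'
    split_ifs at hq' <;> omega
  · have hcompl : bdry E ⊆ bdry E \ contour E p := by
      refine hE.bdry_subset_of_potential Finset.sdiff_subset
        (h := fun u => (if u ∈ E then 1 else 0) - h u) ?_ fun q hq => ?_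
      · simp only [if_pos hE.1, if_neg hE.2.1]
        omega
      · have hq' : h q.1 - h (q.1 + dir N q.2) = (if q ∈ contour E p then 1 else 0) -
            (if (q.1 + dir N q.2, q.2 + 2) ∈ contour E p then 1 else 0) := hh q
        have h₁ := @hsub q
        have h₂ := @hsub (rev q)
        have e : q.1 + dir N q.2 + dir N (q.2 + 2) = q.1 := by
          rw [dir_add_two, add_neg_cancel_right]
        simp only [mem_bdry, rev, e] at h₁ h₂
        rw [Finset.mem_sdiff, mem_bdry]
        split_ifs at hq hq' with k₁ k₂ k₃ k₄ <;> first | omega | tauto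
    have := hcompl hp
    rw [Finset.mem_sdiff] at this
    exact absurd (self_mem_orbit _ p) this.2

/-! ### Short boundaries -/

lemma exists_bdry_of_line {E : Finset (Torus N)} {d : Fin 4} {u : Torus N} (hu : u ∈ E) {t : ℕ}
    (hv : u + t • dir N d ∉ E) : ∃ s < t, (u + s • dir N d, d) ∈ bdry E := by
  induction t with
  | zero => simp [hu] at hv
  | succ t ih =>
    by_cases h : u + t • dir N d ∈ E
    · exact ⟨t, t.lt_succ_self, by
        rw [succ_nsmul, ← add_assoc] at hv
        exact mem_bdry.2 ⟨h, hv⟩⟩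
    · obtain ⟨s, hs, hmem⟩ := ih h
      exact ⟨s, hs.trans t.lt_succ_self, hmem⟩

lemma exists_row_eq {d : Fin 4} (hd : d = 0 ∨ d = 2) (x x' y : ZMod N) :
    ∃ t : ℕ, ((x', y) : Torus N) = (x, y) + t • dir N d := by
  rcases hd with rfl | rfl
  · exact ⟨(x' - x).val, by simp⟩
  · exact ⟨(x - x').val, by simp⟩

lemma exists_column_eq {d : Fin 4} (hd : d = 1 ∨ d = 3) (x y y' : ZMod N) :
    ∃ t : ℕ, ((x, y') : Torus N) = (x, y) + t • dir N d := by
  rcases hd with rfl | rfl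
  · exact ⟨(y' - y).val, by simp⟩
  · exact ⟨(y - y').val, by simp⟩

lemma mem_of_free_row {E : Finset (Torus N)} {r : ZMod N} (hr : ∀ q ∈ bdry E, q.1.2 ≠ r)
    {x : ZMod N} (hx : (x, r) ∈ E) (x' : ZMod N) : (x', r) ∈ E := by
  obtain ⟨t, ht⟩ := exists_row_eq (Or.inl rfl) x x' r
  by_contra h
  obtain ⟨s, -, hs⟩ := exists_bdry_of_line hx (ht ▸ h)
  exact hr _ hs (by simp)

lemma mem_of_free_column {E : Finset (Torus N)} {s : ZMod N} (hs : ∀ q ∈ bdry E, q.1.1 ≠ s)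
    {y : ZMod N} (hy : (s, y) ∈ E) (y' : ZMod N) : (s, y') ∈ E := by
  obtain ⟨t, ht⟩ := exists_column_eq (Or.inl rfl) s y y'
  by_contra h
  obtain ⟨m, -, hm⟩ := exists_bdry_of_line hy (ht ▸ h)
  exact hs _ hm (by simp)

omit [NeZero N] in
lemma exists_nat_lt_free {α : Type*} (S : Finset α) (f : α → ZMod N) (a : ZMod N) {n : ℕ}
    (hS : S.card < n) (hn : n ≤ N) : ∃ t < n, ∀ q ∈ S, f q ≠ a + (t : ZMod N) := by
  by_contra! hcon
  have hsub : (Finset.range n).image (fun t : ℕ => a + (t : ZMod N)) ⊆ S.image f := by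
    intro x hx
    obtain ⟨t, ht, rfl⟩ := Finset.mem_image.1 hx
    obtain ⟨q, hq, hqt⟩ := hcon t (Finset.mem_range.1 ht)
    exact Finset.mem_image.2 ⟨q, hq, hqt⟩
  have hinj : Set.InjOn (fun t : ℕ => a + (t : ZMod N)) (Finset.range n : Set ℕ) := by
    intro t ht t' ht' h
    simp only [Finset.coe_range, Set.mem_Iio] at ht ht'
    have h' := congrArg ZMod.val (add_left_cancel h)
    rwa [ZMod.val_cast_of_lt (ht.trans_le hn), ZMod.val_cast_of_lt (ht'.trans_le hn)] at h'
  have := Finset.card_le_card hsub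
  rw [Finset.card_image_of_injOn hinj, Finset.card_range] at this
  exact absurd (this.trans Finset.card_image_le) (not_le.2 hS)

omit [NeZero N] in
lemma exists_free {α : Type*} (S : Finset α) (f : α → ZMod N) (hS : S.card < N) :
    ∃ r, ∀ q ∈ S, f q ≠ r := by
  obtain ⟨t, -, ht⟩ := exists_nat_lt_free S f 0 hS le_rfl
  exact ⟨_, ht⟩

lemma four_le_card_bdry {E : Finset (Torus N)} {u v : Torus N} (hu : u ∈ E) (hv : v ∉ E)
    (hcard : (bdry E).card < N) : 4 ≤ (bdry E).card := by
  obtain ⟨r, hr⟩ := exists_free (bdry E) (fun q => q.1.2) hcard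
  obtain ⟨s, hs⟩ := exists_free (bdry E) (fun q => q.1.1) hcard
  have hdir : ∀ d : Fin 4, ∃ w ∈ E, ∃ t : ℕ, w + t • dir N d ∉ E := by
    intro d
    have hd : (d = 0 ∨ d = 2) ∨ (d = 1 ∨ d = 3) := by revert d; decide
    obtain ⟨u₁, u₂⟩ := u
    obtain ⟨v₁, v₂⟩ := v
    by_cases h : (s, r) ∈ E
    · rcases hd with hd | hd
      · obtain ⟨t, ht⟩ := exists_row_eq hd s v₁ v₂
        exact ⟨_, mem_of_free_column hs h v₂, t, ht ▸ hv⟩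
      · obtain ⟨t, ht⟩ := exists_column_eq hd v₁ r v₂
        exact ⟨_, mem_of_free_row hr h v₁, t, ht ▸ hv⟩
    · rcases hd with hd | hd
      · obtain ⟨t, ht⟩ := exists_row_eq hd u₁ s u₂
        exact ⟨_, hu, t, ht ▸ fun h' => h (mem_of_free_column hs h' r)⟩
      · obtain ⟨t, ht⟩ := exists_column_eq hd u₁ u₂ r
        exact ⟨_, hu, t, ht ▸ fun h' => h (mem_of_free_row hr h' s)⟩
  have himage : (bdry E).image Prod.snd = Finset.univ := by
    refine Finset.eq_univ_of_forall fun d => ?_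
    obtain ⟨w, hw, t, ht⟩ := hdir d
    obtain ⟨m, -, hm⟩ := exists_bdry_of_line hw ht
    exact Finset.mem_image.2 ⟨_, hm, rfl⟩
  calc 4 = ((bdry E).image Prod.snd).card := by rw [himage]; rfl
    _ ≤ (bdry E).card := Finset.card_image_le

/-- The darts, in both orientations, of the horizontal segment of `n` edges starting at `i`. -/
def anchors (i : Torus N) (n : ℕ) : Finset (Dart N) :=
  (Finset.range n).image (fun t => (i + t • dir N 0, 0)) ∪
    (Finset.range n).image (fun t => rev (i + t • dir N 0, 0))

omit [NeZero N] in
lemma card_anchors_le (i : Torus N) (n : ℕ) : (anchors i n).card ≤ 2 * n := by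
  refine (Finset.card_union_le _ _).trans ?_
  rw [two_mul]
  exact add_le_add (Finset.card_image_le.trans (Finset.card_range n).le)
    (Finset.card_image_le.trans (Finset.card_range n).le)

lemma mem_iff_of_disjoint_anchors {E : Finset (Torus N)} {i : Torus N} {n : ℕ}
    (h : ∀ p ∈ bdry E, p ∉ anchors i n) {t : ℕ} (ht : t ≤ n) : i + t • dir N 0 ∈ E ↔ i ∈ E := by
  induction t with
  | zero => simp
  | succ t ih =>
    rw [← ih (by omega)]
    have h₁ : ((i + t • dir N 0, 0) : Dart N) ∉ bdry E := fun hmem => h _ hmem <|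
      Finset.mem_union_left _ (Finset.mem_image.2 ⟨t, Finset.mem_range.2 ht, rfl⟩)
    have h₂ : rev ((i + t • dir N 0, 0) : Dart N) ∉ bdry E := fun hmem => h _ hmem <|
      Finset.mem_union_right _ (Finset.mem_image.2 ⟨t, Finset.mem_range.2 ht, rfl⟩)
    rw [mem_bdry] at h₁ h₂
    simp only [rev, dir_add_two, add_neg_cancel_right] at h₂
    rw [succ_nsmul, ← add_assoc]
    tauto

lemma exists_anchor {E : Finset (Torus N)} {i j : Torus N} (hi : i ∈ E) (hj : j ∉ E)
    (hcard : (bdry E).card < N) :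
    ∃ p ∈ bdry E, p ∈ anchors i (bdry E).card ∪ anchors j (bdry E).card := by
  by_contra! hcon
  obtain ⟨r, hr⟩ := exists_free (bdry E) (fun q => q.1.2) hcard
  have key : ∀ k : Torus N, (∀ p ∈ bdry E, p ∉ anchors k (bdry E).card) →
      ∃ s, k ∈ E ↔ (s, r) ∈ E := by
    rintro ⟨k₁, k₂⟩ hk
    obtain ⟨t, ht, hfree⟩ := exists_nat_lt_free (bdry E) (fun q => q.1.1) k₁
      (Nat.lt_succ_self _) (Nat.succ_le_of_lt hcard)
    refine ⟨k₁ + t, ?_⟩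
    rw [← mem_iff_of_disjoint_anchors hk (Nat.lt_succ_iff.1 ht)]
    have e : ((k₁, k₂) : Torus N) + t • dir N 0 = (k₁ + t, k₂) := by simp
    rw [e]
    exact ⟨fun h => mem_of_free_column hfree h r, fun h => mem_of_free_column hfree h k₂⟩
  obtain ⟨s, hs⟩ := key i fun p hp h => hcon p hp (Finset.mem_union_left _ h)
  obtain ⟨s', hs'⟩ := key j fun p hp h => hcon p hp (Finset.mem_union_right _ h)
  exact hj (hs'.2 (mem_of_free_row hr (hs.1 hi) s'))

lemma bdry_injOn (i : Torus N) : Set.InjOn bdry {E : Finset (Torus N) | i ∈ E} := by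
  have key : ∀ E F : Finset (Torus N), i ∈ E → i ∈ F → bdry E = bdry F → E ⊆ F := by
    intro E F hE hF h u hu
    have hstep : ∀ w : Torus N, ∀ d : Fin 4, (w ∈ E ↔ w ∈ F) →
        (w + dir N d ∈ E ↔ w + dir N d ∈ F) := by
      intro w d hw
      have h₁ := Finset.ext_iff.1 h (w, d)
      have h₂ := Finset.ext_iff.1 h (rev (w, d))
      simp only [mem_bdry, rev, dir_add_two, add_neg_cancel_right] at h₁ h₂
      tauto
    have hline : ∀ w : Torus N, ∀ d : Fin 4, (w ∈ E ↔ w ∈ F) → ∀ t : ℕ,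
        (w + t • dir N d ∈ E ↔ w + t • dir N d ∈ F) := by
      intro w d hw t
      induction t with
      | zero => simpa using hw
      | succ t ih =>
        rw [succ_nsmul, ← add_assoc]
        exact hstep _ d ih
    obtain ⟨t, ht⟩ := exists_row_eq (Or.inl rfl) i.1 u.1 i.2
    obtain ⟨m, hm⟩ := exists_column_eq (Or.inl rfl) u.1 i.2 u.2
    have h₁ := hline i 0 (by simp [hE, hF]) t
    rw [← ht] at h₁
    have h₂ := hline _ 1 h₁ m
    rw [← hm] at h₂
    exact h₂.1 hu
  exact fun E hE F hF h => (key E F hE hF h).antisymm (key F E hF hE h.symm)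

/-! ### The contour sum -/

lemma sum_sq_mul_pow_le {y : ℝ} (hy : 0 ≤ y) (hy' : y ≤ 3 / 20) (M : ℕ) :
    ∑ n ∈ Finset.Ico 4 M, (n : ℝ) ^ 2 * y ^ n ≤ 23 * y ^ 4 := by
  have hsq : ∀ m : ℕ, ((4 + m : ℕ) : ℝ) ^ 2 ≤ 16 * 2 ^ m := by
    intro m
    induction m with
    | zero => norm_num
    | succ m ih =>
      push_cast at ih ⊢
      have hm : (0 : ℝ) ≤ m := m.cast_nonneg
      rw [pow_succ (2 : ℝ) m]
      nlinarith
  have hgeom : ∑ m ∈ Finset.range (M - 4), (3 / 10 : ℝ) ^ m ≤ 10 / 7 := by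
    rw [geom_sum_eq (by norm_num)]
    have : (0 : ℝ) ≤ (3 / 10) ^ (M - 4) := by positivity
    rw [div_le_iff_of_neg (by norm_num)]
    linarith
  rw [Finset.sum_Ico_eq_sum_range]
  calc ∑ m ∈ Finset.range (M - 4), ((4 + m : ℕ) : ℝ) ^ 2 * y ^ (4 + m)
      ≤ ∑ m ∈ Finset.range (M - 4), 16 * y ^ 4 * (3 / 10 : ℝ) ^ m := by
        refine Finset.sum_le_sum fun m _ => ?_
        have h₁ : (2 * y) ^ m ≤ (3 / 10 : ℝ) ^ m :=
          pow_le_pow_left₀ (by positivity) (by linarith) m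
        calc ((4 + m : ℕ) : ℝ) ^ 2 * y ^ (4 + m)
            ≤ (16 * 2 ^ m) * y ^ (4 + m) :=
              mul_le_mul_of_nonneg_right (hsq m) (by positivity)
          _ = 16 * y ^ 4 * (2 * y) ^ m := by rw [pow_add, mul_pow]; ring
          _ ≤ 16 * y ^ 4 * (3 / 10 : ℝ) ^ m := mul_le_mul_of_nonneg_left h₁ (by positivity)
    _ = 16 * y ^ 4 * ∑ m ∈ Finset.range (M - 4), (3 / 10 : ℝ) ^ m := by rw [Finset.mul_sum]
    _ ≤ 16 * y ^ 4 * (10 / 7) := mul_le_mul_of_nonneg_left hgeom (by positivity)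
    _ ≤ 23 * y ^ 4 := by nlinarith [pow_nonneg hy 4]

/-- The candidate contours of length `n` through the dart `p`. -/
def loops (n : ℕ) (p : Dart N) : Finset (Finset (Dart N)) :=
  (traces move (n - 1) p).filter fun γ => γ.card = n

omit [NeZero N] in
lemma sum_loops_le {z : ℝ} (hz : 0 ≤ z) {n : ℕ} (hn : 0 < n) (p : Dart N) :
    ∑ γ ∈ loops n p, z ^ γ.card ≤ (3 * z) ^ n / 3 := by
  have hcard : ((loops n p).card : ℝ) ≤ 3 ^ (n - 1) := by
    have h := (Finset.card_filter_le (traces move (n - 1) p) fun γ => γ.card = n).trans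
      (card_traces_le move (n - 1) p)
    rw [Fintype.card_fin] at h
    exact_mod_cast h
  calc ∑ γ ∈ loops n p, z ^ γ.card = ∑ γ ∈ loops n p, z ^ n :=
        Finset.sum_congr rfl fun γ hγ => by rw [(Finset.mem_filter.1 hγ).2]
    _ = (loops n p).card * z ^ n := by simp
    _ ≤ 3 ^ (n - 1) * z ^ n := mul_le_mul_of_nonneg_right hcard (by positivity)
    _ = (3 * z) ^ n / 3 := by
        obtain ⟨m, rfl⟩ := Nat.exists_eq_succ_of_ne_zero hn.ne'
        simp only [Nat.succ_eq_add_one, Nat.add_sub_cancel, mul_pow, pow_succ]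
        ring

lemma contour_mem_loops {E : Finset (Torus N)} {p : Dart N} (hp : p ∈ bdry E) :
    contour E p ∈ loops (contour E p).card p :=
  Finset.mem_filter.2 ⟨contour_mem_traces hp, rfl⟩

omit [NeZero N] in
lemma sum_biUnion_loops_le {z : ℝ} (hz : 0 ≤ z) (I : Finset ℕ) (hI : ∀ n ∈ I, 0 < n)
    (A : ℕ → Finset (Dart N)) :
    ∑ γ ∈ I.biUnion fun n => (A n).biUnion fun p => loops n p, z ^ γ.card ≤
      ∑ n ∈ I, (A n).card * ((3 * z) ^ n / 3) := by
  refine (sum_biUnion_le_sum _ _ _ fun γ => by positivity).trans (Finset.sum_le_sum fun n hn => ?_)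
  refine (sum_biUnion_le_sum _ _ _ fun γ => by positivity).trans ?_
  refine (Finset.sum_le_sum fun p _ => sum_loops_le hz (hI n hn) p).trans ?_
  simp

lemma IsMinCut.contour_eq_bdry_of_card_lt {i j : Torus N} {E : Finset (Torus N)}
    (hE : IsMinCut i j E) {p : Dart N} (hp : p ∈ bdry E) (hcard : (contour E p).card < N) :
    contour E p = bdry E := by
  obtain ⟨r, hr⟩ := exists_free (contour E p) (fun q => q.1.2) hcard
  obtain ⟨s, hs⟩ := exists_free (contour E p) (fun q => q.1.1) hcard
  exact hE.contour_eq_bdry hp hr hs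

open scoped Classical in
/-- The minimal cuts separating `i` from `j`. -/
noncomputable def minCuts (i j : Torus N) : Finset (Finset (Torus N)) :=
  Finset.univ.filter (IsMinCut i j)

@[simp] lemma mem_minCuts {i j : Torus N} {E : Finset (Torus N)} :
    E ∈ minCuts i j ↔ IsMinCut i j E := by
  simp [minCuts]

lemma sum_short_minCuts_le {z : ℝ} (hz : 0 ≤ z) (hz' : 3 * z ≤ 3 / 20) (i j : Torus N) :
    ∑ E ∈ (minCuts i j).filter (fun E => (bdry E).card < N), z ^ (bdry E).card ≤
      8 * (3 * z) ^ 4 := by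
  set C := (minCuts i j).filter (fun E => (bdry E).card < N) with hC
  set A : ℕ → Finset (Dart N) := fun n => anchors i n ∪ anchors j n with hA
  set L : Finset (Finset (Dart N)) := (Finset.Ico 4 N).biUnion fun n =>
    (A n).biUnion fun p => loops n p with hL
  have hAsq : ∀ n, 4 ≤ n → ((A n).card : ℝ) ≤ (n : ℝ) ^ 2 := fun n hn => by
    have h := calc (A n).card ≤ (anchors i n).card + (anchors j n).card :=
          Finset.card_union_le _ _
      _ ≤ 2 * n + 2 * n := add_le_add (card_anchors_le i n) (card_anchors_le j n)
      _ = 4 * n := by ring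
      _ ≤ n ^ 2 := by rw [sq]; exact Nat.mul_le_mul_right n hn
    exact_mod_cast h
  have hmem : ∀ E ∈ C, IsMinCut i j E ∧ (bdry E).card < N := fun E hE => by
    simpa [hC] using hE
  have hinj : Set.InjOn bdry (C : Set (Finset (Torus N))) := fun E hE F hF h =>
    bdry_injOn i (hmem E hE).1.1 (hmem F hF).1.1 h
  have hsub : C.image bdry ⊆ L := by
    intro γ hγ
    obtain ⟨E, hE, rfl⟩ := Finset.mem_image.1 hγ
    obtain ⟨hE, hcard⟩ := hmem E hE
    obtain ⟨p, hp, hanchor⟩ := exists_anchor hE.1 hE.2.1 hcard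
    have heq := hE.contour_eq_bdry_of_card_lt hp
      ((Finset.card_le_card (contour_subset_bdry hp)).trans_lt hcard)
    refine Finset.mem_biUnion.2 ⟨(bdry E).card,
      Finset.mem_Ico.2 ⟨four_le_card_bdry hE.1 hE.2.1 hcard, hcard⟩,
      Finset.mem_biUnion.2 ⟨p, hanchor, ?_⟩⟩
    have := contour_mem_loops hp
    rwa [heq] at this
  calc ∑ E ∈ C, z ^ (bdry E).card = ∑ γ ∈ C.image bdry, z ^ γ.card :=
        (Finset.sum_image (f := fun γ => z ^ γ.card) hinj).symm
    _ ≤ ∑ γ ∈ L, z ^ γ.card :=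
        Finset.sum_le_sum_of_subset_of_nonneg hsub fun _ _ _ => by positivity
    _ ≤ ∑ n ∈ Finset.Ico 4 N, ((A n).card : ℝ) * ((3 * z) ^ n / 3) :=
        sum_biUnion_loops_le hz _ (fun n hn => by
          have := (Finset.mem_Ico.1 hn).1
          omega) _
    _ ≤ ∑ n ∈ Finset.Ico 4 N, (1 / 3) * ((n : ℝ) ^ 2 * (3 * z) ^ n) := by
        refine Finset.sum_le_sum fun n hn => ?_
        refine (mul_le_mul_of_nonneg_right (hAsq n (Finset.mem_Ico.1 hn).1)
          (by positivity : (0 : ℝ) ≤ (3 * z) ^ n / 3)).trans_eq ?_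
        ring
    _ = (1 / 3) * ∑ n ∈ Finset.Ico 4 N, (n : ℝ) ^ 2 * (3 * z) ^ n := by rw [Finset.mul_sum]
    _ ≤ 8 * (3 * z) ^ 4 := by
        have := sum_sq_mul_pow_le (by positivity : 0 ≤ 3 * z) hz' N
        have h0 : 0 ≤ (3 * z) ^ 4 := by positivity
        linarith

/-- The set of contours of `E`. -/
noncomputable def contours (E : Finset (Torus N)) : Finset (Finset (Dart N)) :=
  (bdry E).image (contour E)

lemma biUnion_contours (E : Finset (Torus N)) : (contours E).biUnion id = bdry E := by
  ext q
  simp only [contours, Finset.mem_biUnion, Finset.mem_image, id]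
  constructor
  · rintro ⟨_, ⟨p, hp, rfl⟩, hq⟩
    exact contour_subset_bdry hp hq
  · exact fun hq => ⟨_, ⟨q, hq, rfl⟩, self_mem_orbit _ q⟩

lemma prod_contours (E : Finset (Torus N)) (z : ℝ) :
    ∏ γ ∈ contours E, z ^ γ.card = z ^ (bdry E).card := by
  rw [Finset.prod_pow_eq_pow_sum, ← biUnion_contours E, Finset.card_biUnion]
  · rfl
  · intro γ hγ δ hδ hne
    obtain ⟨p, -, rfl⟩ := Finset.mem_image.1 hγ
    obtain ⟨q, -, rfl⟩ := Finset.mem_image.1 hδ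
    refine Finset.disjoint_left.2 fun r hr hr' => hne ?_
    exact (orbit_eq hr).symm.trans (orbit_eq hr')

lemma sum_long_minCuts_le (hN : 4 ≤ N) {z : ℝ} (hz : 0 ≤ z) (hz' : 3 * z ≤ 3 / 20)
    (i j : Torus N) :
    ∑ E ∈ (minCuts i j).filter (fun E => ¬ (bdry E).card < N), z ^ (bdry E).card ≤
      62 * (3 * z) ^ 4 := by
  set C := (minCuts i j).filter (fun E => ¬ (bdry E).card < N) with hC
  set M := Fintype.card (Dart N) + 1 with hM
  set L : Finset (Finset (Dart N)) := (Finset.Ico N M).biUnion fun n =>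
    (Finset.univ : Finset (Dart N)).biUnion fun p => loops n p with hL
  have hmem : ∀ E ∈ C, IsMinCut i j E ∧ N ≤ (bdry E).card := fun E hE => by
    simpa [hC] using hE
  have hinj : Set.InjOn contours (C : Set (Finset (Torus N))) := by
    intro E hE F hF h
    refine bdry_injOn i (hmem E hE).1.1 (hmem F hF).1.1 ?_
    rw [← biUnion_contours, h, biUnion_contours]
  have hsub : C.image contours ⊆ L.powerset.erase ∅ := by
    intro T hT
    obtain ⟨E, hE, rfl⟩ := Finset.mem_image.1 hT
    obtain ⟨hcut, hcard⟩ := hmem E hE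
    have hne : (bdry E).Nonempty := Finset.card_pos.1 (by omega)
    refine Finset.mem_erase.2 ⟨(hne.image _).ne_empty, Finset.mem_powerset.2 fun γ hγ => ?_⟩
    obtain ⟨p, hp, rfl⟩ := Finset.mem_image.1 hγ
    refine Finset.mem_biUnion.2 ⟨(contour E p).card, Finset.mem_Ico.2 ⟨?_, ?_⟩,
      Finset.mem_biUnion.2 ⟨p, Finset.mem_univ p, contour_mem_loops hp⟩⟩
    · by_contra! hlt
      have := hcut.contour_eq_bdry_of_card_lt hp hlt
      rw [this] at hlt
      omega
    · exact Nat.lt_succ_of_le (Finset.card_le_univ _)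
  have hW : ∑ γ ∈ L, z ^ γ.card ≤ 31 * (3 * z) ^ 4 := by
    calc ∑ γ ∈ L, z ^ γ.card
        ≤ ∑ n ∈ Finset.Ico N M, ((Finset.univ : Finset (Dart N)).card : ℝ) * ((3 * z) ^ n / 3) :=
          sum_biUnion_loops_le hz _ (fun n hn => by
            have := (Finset.mem_Ico.1 hn).1
            omega) _
      _ ≤ ∑ n ∈ Finset.Ico N M, (4 / 3) * ((n : ℝ) ^ 2 * (3 * z) ^ n) := by
          refine Finset.sum_le_sum fun n hn => ?_
          have hn : (N : ℝ) ≤ n := by exact_mod_cast (Finset.mem_Ico.1 hn).1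
          have hsq : (N : ℝ) ^ 2 ≤ (n : ℝ) ^ 2 := pow_le_pow_left₀ (by positivity) hn 2
          have hcard : ((Finset.univ : Finset (Dart N)).card : ℝ) = N ^ 2 * 4 := by
            simp [Finset.card_univ, ZMod.card, sq]
          rw [hcard]
          have := mul_le_mul_of_nonneg_right hsq (by positivity : (0 : ℝ) ≤ (3 * z) ^ n)
          linarith
      _ ≤ ∑ n ∈ Finset.Ico 4 M, (4 / 3) * ((n : ℝ) ^ 2 * (3 * z) ^ n) :=
          Finset.sum_le_sum_of_subset_of_nonneg (Finset.Ico_subset_Ico_left hN)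
            fun _ _ _ => by positivity
      _ = (4 / 3) * ∑ n ∈ Finset.Ico 4 M, (n : ℝ) ^ 2 * (3 * z) ^ n := by rw [Finset.mul_sum]
      _ ≤ 31 * (3 * z) ^ 4 := by
          have := sum_sq_mul_pow_le (by positivity : 0 ≤ 3 * z) hz' M
          have h0 : 0 ≤ (3 * z) ^ 4 := by positivity
          linarith
  have hW0 : 0 ≤ ∑ γ ∈ L, z ^ γ.card := Finset.sum_nonneg fun _ _ => by positivity
  have hW1 : ∑ γ ∈ L, z ^ γ.card ≤ 1 := by
    have : (3 * z) ^ 4 ≤ (3 / 20 : ℝ) ^ 4 := pow_le_pow_left₀ (by positivity) hz' 4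
    norm_num at this
    linarith
  calc ∑ E ∈ C, z ^ (bdry E).card = ∑ E ∈ C, ∏ γ ∈ contours E, z ^ γ.card :=
        Finset.sum_congr rfl fun E _ => (prod_contours E z).symm
    _ = ∑ T ∈ C.image contours, ∏ γ ∈ T, z ^ γ.card :=
        (Finset.sum_image (f := fun T => ∏ γ ∈ T, z ^ γ.card) hinj).symm
    _ ≤ ∑ T ∈ L.powerset.erase ∅, ∏ γ ∈ T, z ^ γ.card :=
        Finset.sum_le_sum_of_subset_of_nonneg hsub fun _ _ _ => by positivity
    _ = ∏ γ ∈ L, (1 + z ^ γ.card) - 1 := by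
        rw [Finset.prod_one_add, ← Finset.sum_erase_add _ _ (Finset.empty_mem_powerset L)]
        simp
    _ ≤ Real.exp (∑ γ ∈ L, z ^ γ.card) - 1 :=
        sub_le_sub_right (Real.prod_one_add_le_exp_sum L fun _ => by positivity) 1
    _ ≤ 2 * ∑ γ ∈ L, z ^ γ.card := by
        have := Real.abs_exp_sub_one_le (x := ∑ γ ∈ L, z ^ γ.card) (by rwa [abs_of_nonneg hW0])
        rw [abs_of_nonneg hW0] at this
        exact (le_abs_self _).trans this
    _ ≤ 62 * (3 * z) ^ 4 := by linarith

lemma sum_minCuts_le (hN : 4 ≤ N) {z : ℝ} (hz : 0 ≤ z) (hz' : 3 * z ≤ 3 / 20) (i j : Torus N) :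
    ∑ E ∈ minCuts i j, z ^ (bdry E).card ≤ 480 * (3 * z) ^ 4 := by
  rw [← Finset.sum_filter_add_sum_filter_not _ fun E => (bdry E).card < N]
  have h₁ := sum_short_minCuts_le hz hz' i j
  have h₂ := sum_long_minCuts_le hN hz hz' i j
  have h₃ : 0 ≤ (3 * z) ^ 4 := by positivity
  linarith

/-! ### Lowering a height function inside a cut -/

lemma card_bdry (E : Finset (Torus N)) :
    ((bdry E).card : ℝ) = ∑ u : Torus N,
      (((if (u, 0) ∈ bdry E then 1 else 0) + if (u + dir N 0, 2) ∈ bdry E then 1 else 0) +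
        ((if (u, 1) ∈ bdry E then 1 else 0) + if (u + dir N 1, 3) ∈ bdry E then 1 else 0)) := by
  have hshift : ∀ d e : Fin 4, ∑ u : Torus N, (if (u + dir N d, e) ∈ bdry E then (1 : ℝ) else 0) =
      ∑ u : Torus N, if (u, e) ∈ bdry E then (1 : ℝ) else 0 := fun d e =>
    Equiv.sum_comp (Equiv.addRight (dir N d)) fun u => if (u, e) ∈ bdry E then (1 : ℝ) else 0
  have hcard : ((bdry E).card : ℝ) = ∑ p : Dart N, if p ∈ bdry E then (1 : ℝ) else 0 := by
    rw [Finset.sum_boole, Finset.filter_univ_mem]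
  rw [hcard, Fintype.sum_prod_type]
  simp only [Fin.sum_univ_four, Finset.sum_add_distrib, hshift]
  ring

/-- Lower `f` by one on `E`, then shift it so that the value at the origin is unchanged. -/
def lower (E : Finset (Torus N)) (f : Torus N → ℤ) (v : Torus N) : ℤ :=
  f v - (if v ∈ E then 1 else 0) + if 0 ∈ E then 1 else 0

lemma sq_lower_add_le {E : Finset (Torus N)} {f : Torus N → ℤ}
    (hf : ∀ p ∈ bdry E, f (p.1 + dir N p.2) < f p.1) (u : Torus N) (d : Fin 4) :
    ((lower E f (u + dir N d) - lower E f u : ℤ) : ℝ) ^ 2 +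
      ((if (u, d) ∈ bdry E then 1 else 0) +
        if (u + dir N d, d + 2) ∈ bdry E then 1 else 0) ≤
      ((f (u + dir N d) - f u : ℤ) : ℝ) ^ 2 := by
  have h₁ := hf (u, d)
  have h₂ := hf (u + dir N d, d + 2)
  simp only [mem_bdry, dir_add_two, add_neg_cancel_right] at h₁ h₂ ⊢
  norm_cast
  by_cases hu : u ∈ E <;> by_cases hv : u + dir N d ∈ E <;>
    simp only [hu, hv, lower, not_true_eq_false, not_false_eq_true, and_self, and_true, and_false,
      if_true, if_false, forall_const] at h₁ h₂ ⊢ <;> push_cast <;> nlinarith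

lemma dgHam_lower_add_card_le {E : Finset (Torus N)} {f : Torus N → ℤ}
    (hf : ∀ p ∈ bdry E, f (p.1 + dir N p.2) < f p.1) :
    dgHam N (lower E f) + (bdry E).card ≤ dgHam N f := by
  rw [card_bdry, dgHam, dgHam, ← Finset.sum_add_distrib]
  refine Finset.sum_le_sum fun u _ => ?_
  have h₀ := sq_lower_add_le hf u 0
  have h₁ := sq_lower_add_le hf u 1
  simp only [dir, zero_add] at h₀ h₁ ⊢
  exact (add_add_add_comm _ _ _ _).trans_le (add_le_add h₀ h₁)

/-- Lowering on `E` as a bijection of the pinned height functions. -/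
def lowerEquiv (E : Finset (Torus N)) :
    {f : Torus N → ℤ // f 0 = 0} ≃ {f : Torus N → ℤ // f 0 = 0} where
  toFun f := ⟨lower E f.1, by simp [lower, f.2]⟩
  invFun f := ⟨fun v => f.1 v + (if v ∈ E then 1 else 0) - if 0 ∈ E then 1 else 0, by simp [f.2]⟩
  left_inv f := by ext v; simp only [lower]; ring
  right_inv f := by ext v; simp only [lower]; ring

lemma IsMinCut.lower_sub {i j : Torus N} {E : Finset (Torus N)} (hE : IsMinCut i j E)
    (f : Torus N → ℤ) : lower E f i - lower E f j = f i - f j - 1 := by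
  simp only [lower, hE.1, hE.2.1, if_true, if_false]
  ring

/-! ### The Gibbs weights -/

/-- The Boltzmann weight of `x` on the event `k ≤ x i - x j`. -/
noncomputable def tailWeight (β : ℝ) (i j : Torus N) (k : ℕ)
    (x : {f : Torus N → ℤ // f 0 = 0}) : ℝ :=
  if (k : ℤ) ≤ x.1 i - x.1 j then Real.exp (-β * dgHam N x.1) else 0

lemma tailWeight_nonneg (β : ℝ) (i j : Torus N) (k : ℕ) (x : {f : Torus N → ℤ // f 0 = 0}) :
    0 ≤ tailWeight β i j k x := by
  unfold tailWeight
  split_ifs <;> positivity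

lemma tailWeight_le (β : ℝ) (i j : Torus N) (k : ℕ) (x : {f : Torus N → ℤ // f 0 = 0}) :
    tailWeight β i j k x ≤ Real.exp (-β * dgHam N x.1) := by
  unfold tailWeight
  split_ifs
  · rfl
  · positivity

lemma tailWeight_succ_le {β : ℝ} (hβ : 0 ≤ β) (i j : Torus N) (k : ℕ)
    (x : {f : Torus N → ℤ // f 0 = 0}) :
    tailWeight β i j (k + 1) x ≤ ∑ E ∈ minCuts i j,
      Real.exp (-β) ^ (bdry E).card * tailWeight β i j k (lowerEquiv E x) := by
  have hterm : ∀ E ∈ minCuts i j,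
      0 ≤ Real.exp (-β) ^ (bdry E).card * tailWeight β i j k (lowerEquiv E x) := fun E _ =>
    mul_nonneg (by positivity) (tailWeight_nonneg _ _ _ _ _)
  by_cases hx : ((k + 1 : ℕ) : ℤ) ≤ x.1 i - x.1 j
  · obtain ⟨E, hE, hsub⟩ := exists_isMinCut (i := i) (j := j)
      (D := Finset.univ.filter fun v => x.1 j < x.1 v)
      (by simp only [Finset.mem_filter, Finset.mem_univ, true_and]; omega) (by simp)
    refine le_trans ?_ (Finset.single_le_sum hterm (mem_minCuts.2 hE))
    have hlow : (k : ℤ) ≤ (lowerEquiv E x).1 i - (lowerEquiv E x).1 j := by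
      have := hE.lower_sub x.1
      change (k : ℤ) ≤ lower E x.1 i - lower E x.1 j
      push_cast at hx
      omega
    have hdrop : dgHam N (lowerEquiv E x).1 + (bdry E).card ≤ dgHam N x.1 := by
      refine dgHam_lower_add_card_le fun p hp => ?_
      have := mem_bdry.1 (hsub hp)
      simp only [Finset.mem_filter, Finset.mem_univ, true_and, not_lt] at this
      exact this.2.trans_lt this.1
    rw [tailWeight, tailWeight, if_pos hx, if_pos hlow, ← Real.exp_nat_mul, ← Real.exp_add]
    refine Real.exp_le_exp.2 ?_
    nlinarith
  · rw [tailWeight, if_neg hx]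
    exact Finset.sum_nonneg hterm

lemma summable_tailWeight {β : ℝ}
    (hw : Summable fun x : {f : Torus N → ℤ // f 0 = 0} => Real.exp (-β * dgHam N x.1))
    (i j : Torus N) (k : ℕ) : Summable (tailWeight β i j k) :=
  hw.of_nonneg_of_le (tailWeight_nonneg β i j k) (tailWeight_le β i j k)

lemma tsum_tailWeight_succ_le {β : ℝ}
    (hw : Summable fun x : {f : Torus N → ℤ // f 0 = 0} => Real.exp (-β * dgHam N x.1))
    (hβ : 0 ≤ β) (i j : Torus N) (k : ℕ) :
    ∑' x, tailWeight β i j (k + 1) x ≤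
      (∑ E ∈ minCuts i j, Real.exp (-β) ^ (bdry E).card) * ∑' x, tailWeight β i j k x := by
  have hsum : ∀ E ∈ minCuts i j, Summable fun x =>
      Real.exp (-β) ^ (bdry E).card * tailWeight β i j k (lowerEquiv E x) := fun E _ =>
    (((lowerEquiv E).summable_iff).2 (summable_tailWeight hw i j k)).mul_left _
  calc ∑' x, tailWeight β i j (k + 1) x
      ≤ ∑' x, ∑ E ∈ minCuts i j,
          Real.exp (-β) ^ (bdry E).card * tailWeight β i j k (lowerEquiv E x) :=
        (summable_tailWeight hw i j (k + 1)).tsum_le_tsum (tailWeight_succ_le hβ i j k)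
          (summable_sum hsum)
    _ = ∑ E ∈ minCuts i j, Real.exp (-β) ^ (bdry E).card * ∑' x, tailWeight β i j k x := by
        rw [Summable.tsum_finsetSum hsum]
        refine Finset.sum_congr rfl fun E _ => ?_
        rw [tsum_mul_left, (lowerEquiv E).tsum_eq]
    _ = _ := (Finset.sum_mul _ _ _).symm

lemma tsum_tailWeight_le {β : ℝ}
    (hw : Summable fun x : {f : Torus N → ℤ // f 0 = 0} => Real.exp (-β * dgHam N x.1))
    (hN : 4 ≤ N) (hβ : 3 ≤ β) (i j : Torus N) (k : ℕ) :
    ∑' x, tailWeight β i j k x ≤ (480 * (3 * Real.exp (-β)) ^ 4) ^ k *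
      ∑' x : {f : Torus N → ℤ // f 0 = 0}, Real.exp (-β * dgHam N x.1) := by
  have hz : 3 * Real.exp (-β) ≤ 3 / 20 := by
    have h : (20 : ℝ) ≤ Real.exp β := by
      calc (20 : ℝ) ≤ 2.7182818283 ^ 3 := by norm_num
        _ ≤ Real.exp 1 ^ 3 := pow_le_pow_left₀ (by norm_num) Real.exp_one_gt_d9.le 3
        _ = Real.exp 3 := by rw [← Real.exp_nat_mul]; norm_num
        _ ≤ Real.exp β := Real.exp_le_exp.2 hβ
    have := inv_anti₀ (by norm_num) h
    rw [Real.exp_neg]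
    linarith
  induction k with
  | zero =>
    rw [pow_zero, one_mul]
    exact (summable_tailWeight hw i j 0).tsum_le_tsum (tailWeight_le β i j 0) hw
  | succ k ih =>
    refine (tsum_tailWeight_succ_le hw (by linarith) i j k).trans ?_
    rw [pow_succ', mul_assoc]
    exact mul_le_mul (sum_minCuts_le hN (Real.exp_pos _).le hz i j) ih
      (tsum_nonneg (tailWeight_nonneg β i j k)) (by positivity)

end Boundary

end DiscreteGaussian

/-- For `β ≥ 3`, on any `N × N` torus with `N ≥ 4` and pinned at the origin, the discrete
Gaussian Gibbs measure satisfies `P_{Λ,β}(|x_i − x_j| ≥ k) ≤ 2 φ(β)ᵏ` for every `k ≥ 1`,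
where `φ(β) = 480 (3 e^{−β})⁴`. -/
theorem stmt16 (N : ℕ) [NeZero N] (hN : 4 ≤ N) (β : ℝ) (hβ : 3 ≤ β)
    (i j : Torus N) (k : ℕ) (hk : 1 ≤ k) :
    (∑' x : {f : Torus N → ℤ // f 0 = 0},
        if (k : ℤ) ≤ |x.1 i - x.1 j| then Real.exp (-β * dgHam N x.1) else 0) /
      (∑' x : {f : Torus N → ℤ // f 0 = 0}, Real.exp (-β * dgHam N x.1))
      ≤ 2 * (480 * (3 * Real.exp (-β)) ^ 4) ^ k := by
  set w : {f : Torus N → ℤ // f 0 = 0} → ℝ := fun x => Real.exp (-β * dgHam N x.1) with hwdef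
  set r : ℝ := (480 * (3 * Real.exp (-β)) ^ 4) ^ k with hr
  have hr0 : 0 ≤ r := by positivity
  by_cases hw : Summable w
  swap
  · rw [tsum_eq_zero_of_not_summable hw, div_zero]
    positivity
  refine div_le_of_le_mul₀ (tsum_nonneg fun x => (Real.exp_pos _).le) (by positivity) ?_
  have hij := DiscreteGaussian.summable_tailWeight hw i j k
  have hji := DiscreteGaussian.summable_tailWeight hw j i k
  have hle : ∀ x : {f : Torus N → ℤ // f 0 = 0},
      (if (k : ℤ) ≤ |x.1 i - x.1 j| then Real.exp (-β * dgHam N x.1) else 0) ≤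
        DiscreteGaussian.tailWeight β i j k x + DiscreteGaussian.tailWeight β j i k x := by
    intro x
    have h₁ := DiscreteGaussian.tailWeight_nonneg β i j k x
    have h₂ := DiscreteGaussian.tailWeight_nonneg β j i k x
    split_ifs with h
    · rcases le_abs'.1 h with h | h
      · have h' : DiscreteGaussian.tailWeight β j i k x = Real.exp (-β * dgHam N x.1) :=
          if_pos (by omega)
        linarith
      · have h' : DiscreteGaussian.tailWeight β i j k x = Real.exp (-β * dgHam N x.1) := if_pos h
        linarith
    · positivity
  have hnonneg : ∀ x : {f : Torus N → ℤ // f 0 = 0},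
      0 ≤ if (k : ℤ) ≤ |x.1 i - x.1 j| then Real.exp (-β * dgHam N x.1) else 0 := by
    intro x
    split_ifs <;> positivity
  calc _ ≤ ∑' x, (DiscreteGaussian.tailWeight β i j k x + DiscreteGaussian.tailWeight β j i k x) :=
        ((hij.add hji).of_nonneg_of_le hnonneg hle).tsum_le_tsum hle (hij.add hji)
    _ = ∑' x, DiscreteGaussian.tailWeight β i j k x +
          ∑' x, DiscreteGaussian.tailWeight β j i k x := hij.tsum_add hji
    _ ≤ r * ∑' x, w x + r * ∑' x, w x :=
        add_le_add (DiscreteGaussian.tsum_tailWeight_le hw hN hβ i j k)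
          (DiscreteGaussian.tsum_tailWeight_le hw hN hβ j i k)
    _ = 2 * r * ∑' x, w x := by ring
end
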